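/- Let K be a convex body in ℝⁿ with V(K) = V(B), and let e_{-2}(K) be an interior point of K minimizing x ↦ ∫_{S^{n-1}} (s_K(u) − x·u)^{-2} dθ over int K. Then ∫_{S^{n-1}} log(s_K(u) − e_{-2}(K)·u) dθ ≥ 0. -/

import Mathlib

open MeasureTheory Metric Real Set
open scoped Pointwise RealInnerProductSpace

noncomputable section

/-- The surface measure `dθ` on the unit sphere `S^{n-1}` of `ℝⁿ`
(its total mass is `n·V(B)`). -/
def sphMeasure (n : ℕ) : Measure (Metric.sphere (0 : EuclideanSpace ℝ (Fin n)) 1) :=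
  (volume : Measure (EuclideanSpace ℝ (Fin n))).toSphere

/-- `K` is a convex body: compact, convex, with nonempty interior. -/
def IsConvexBody {n : ℕ} (K : Set (EuclideanSpace ℝ (Fin n))) : Prop :=
  IsCompact K ∧ Convex ℝ K ∧ (interior K).Nonempty

/-- The support function of `K`: `s_K(u) = max_{x ∈ K} x·u`. -/
def supp {n : ℕ} (K : Set (EuclideanSpace ℝ (Fin n))) (u : EuclideanSpace ℝ (Fin n)) : ℝ :=
  sSup ((fun x => ⟪x, u⟫) '' K)

/-- `n`-dimensional Lebesgue measure (volume), as a real number. -/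
def vol {n : ℕ} (K : Set (EuclideanSpace ℝ (Fin n))) : ℝ :=
  (volume K).toReal

/-- The closed unit ball `B` of `ℝⁿ`. -/
def unitBall (n : ℕ) : Set (EuclideanSpace ℝ (Fin n)) :=
  Metric.closedBall 0 1

/-- The entropy functional `𝓔(K) = sup_{x ∈ int K} ∫_{S^{n-1}} log (s_K(u) - x·u) dθ`. -/
def entropy {n : ℕ} (K : Set (EuclideanSpace ℝ (Fin n))) : ℝ :=
  sSup ((fun x => ∫ u, Real.log (supp K u - ⟪x, (u : EuclideanSpace ℝ (Fin n))⟫)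
      ∂(sphMeasure n)) '' interior K)

/-- The `p`-entropy functional `𝓔_p(K) = inf_{x ∈ int K} ∫_{S^{n-1}} (s_K(u) - x·u)^p dθ`. -/
def entropyP {n : ℕ} (p : ℝ) (K : Set (EuclideanSpace ℝ (Fin n))) : ℝ :=
  sInf ((fun x => ∫ u, (supp K u - ⟪x, (u : EuclideanSpace ℝ (Fin n))⟫) ^ p
      ∂(sphMeasure n)) '' interior K)

/-- The Hausdorff distance between convex bodies,
`δ_H(K,L) = sup_{u ∈ S^{n-1}} |s_K(u) - s_L(u)|`. -/
def hdist {n : ℕ} (K L : Set (EuclideanSpace ℝ (Fin n))) : ℝ :=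
  ⨆ u : Metric.sphere (0 : EuclideanSpace ℝ (Fin n)) 1, |supp K u - supp L u|

open scoped ENNReal


lemma bm_compact {A B D : Set ℝ} (hA : IsCompact A) (hB : IsCompact B) (hAn : A.Nonempty)
    (hBn : B.Nonempty) (hD : ∀ a ∈ A, ∀ b ∈ B, a + b ∈ D) :
    volume A + volume B ≤ volume D := by
  obtain ⟨a, ha, hamax⟩ := hA.exists_isMaxOn hAn continuous_id.continuousOn
  obtain ⟨b, hb, hbmin⟩ := hB.exists_isMinOn hBn continuous_id.continuousOn
  have h1 : volume A = volume ((fun x => x + b) '' A) := by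
    rw [Set.image_add_right, measure_preimage_add_right]
  have h2 : volume B = volume ((fun x => a + x) '' B) := by
    rw [Set.image_add_left, measure_preimage_add]
  have hBc : MeasurableSet ((fun x => a + x) '' B) :=
    (hB.image (by fun_prop)).measurableSet
  rw [h1, h2, ← measure_union₀ hBc.nullMeasurableSet]
  · apply measure_mono
    rintro x (⟨y, hy, rfl⟩ | ⟨y, hy, rfl⟩)
    · exact hD _ hy _ hb
    · exact hD _ ha _ hy
  · refine measure_mono_null (t := {a + b}) ?_ (by simp)
    rintro x ⟨⟨y, hy, rfl⟩, ⟨y', hy', h⟩⟩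
    have e1 : y ≤ a := hamax hy
    have e2 : b ≤ y' := hbmin hy'
    simp only [mem_singleton_iff]
    simp only at h ⊢
    linarith

lemma bm_meas {A B D : Set ℝ} (hA : MeasurableSet A) (hB : MeasurableSet B) (hAn : A.Nonempty)
    (hBn : B.Nonempty) (hD : ∀ a ∈ A, ∀ b ∈ B, a + b ∈ D) :
    volume A + volume B ≤ volume D := by
  obtain ⟨a, ha⟩ := hAn
  obtain ⟨b, hb⟩ := hBn
  rw [hA.measure_eq_iSup_isCompact, hB.measure_eq_iSup_isCompact]
  simp only [iSup_and']
  refine ENNReal.biSup_add_biSup_le' (p := fun K : Set ℝ => K ⊆ A ∧ IsCompact K)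
    (q := fun K : Set ℝ => K ⊆ B ∧ IsCompact K)
    ⟨∅, by simp, isCompact_empty⟩ ⟨∅, by simp, isCompact_empty⟩ ?_
  rintro K ⟨hKA, hK⟩ L ⟨hLB, hL⟩
  calc volume K + volume L ≤ volume (insert a K) + volume (insert b L) := by
        gcongr <;> simp
    _ ≤ volume D := bm_compact (hK.insert a) (hL.insert b) (by simp) (by simp) (by
        intro x hx y hy
        exact hD x (insert_subset ha hKA hx) y (insert_subset hb hLB hy))

lemma pl_core {φ ψ k : ℝ → ℝ} (hφ : Measurable φ) (hψ : Measurable ψ) (hk : Measurable k)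
    (hφ0 : ∀ x, 0 ≤ φ x) (hψ0 : ∀ x, 0 ≤ ψ x) (hk0 : ∀ x, 0 ≤ k x)
    (hφ1 : ∀ x, φ x ≤ 1) (hψ1 : ∀ x, ψ x ≤ 1)
    (hφs : ∀ t < 1, ∃ x, t < φ x) (hψs : ∀ t < 1, ∃ x, t < ψ x)
    (h : ∀ a b, φ a * ψ b ≤ k (a + b) ^ 2) :
    (∫⁻ x, ENNReal.ofReal (φ x)) + (∫⁻ x, ENNReal.ofReal (ψ x)) ≤
      ∫⁻ x, ENNReal.ofReal (k x) := by
  rw [lintegral_eq_lintegral_meas_lt _ (.of_forall hφ0) hφ.aemeasurable,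
    lintegral_eq_lintegral_meas_lt _ (.of_forall hψ0) hψ.aemeasurable,
    lintegral_eq_lintegral_meas_lt _ (.of_forall hk0) hk.aemeasurable, ← lintegral_add_left']
  · apply setLIntegral_mono_ae'
    · exact measurableSet_Ioi
    · refine .of_forall fun t (ht : 0 < t) => ?_
      by_cases ht1 : t < 1
      · refine bm_meas (measurableSet_lt measurable_const hφ) (measurableSet_lt measurable_const hψ)
          (hφs t ht1) (hψs t ht1) ?_
        intro a (ha : t < φ a) b (hb : t < ψ b)
        show t < k (a + b)
        have := h a b
        have h0 := hk0 (a + b)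
        by_contra hc
        push Not at hc
        nlinarith
      · push Not at ht1
        have e1 : {a | t < φ a} = ∅ := by
          ext a; simp; linarith [hφ1 a]
        have e2 : {a | t < ψ a} = ∅ := by
          ext a; simp; linarith [hψ1 a]
        simp [e1, e2]
  · refine Measurable.aemeasurable (Antitone.measurable ?_)
    intro s t hst
    exact measure_mono fun x hx => lt_of_le_of_lt hst hx

lemma ennreal_amgm (p q : ℝ≥0∞) : 4 * (p * q) ≤ (p + q) ^ 2 := by
  by_cases hp : p = ∞
  · subst hp; simp
  by_cases hq : q = ∞
  · subst hq; simp
  lift p to NNReal using hp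
  lift q to NNReal using hq
  norm_cast
  have : (4 * (p * q) : ℝ) ≤ (p + q) ^ 2 := by nlinarith [sq_nonneg ((p:ℝ) - q)]
  exact_mod_cast this

lemma pl_real {φ ψ k : ℝ → ℝ} (hφ : Measurable φ) (hψ : Measurable ψ) (hk : Measurable k)
    (hφ0 : ∀ x, 0 ≤ φ x) (hψ0 : ∀ x, 0 ≤ ψ x) (hk0 : ∀ x, 0 ≤ k x)
    (hφb : BddAbove (range φ)) (hψb : BddAbove (range ψ)) (hφp : ∃ x, 0 < φ x) (hψp : ∃ x, 0 < ψ x)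
    (h : ∀ a b, φ a * ψ b ≤ k (a + b) ^ 2) :
    4 * ((∫⁻ x, ENNReal.ofReal (φ x)) * (∫⁻ x, ENNReal.ofReal (ψ x))) ≤
      (∫⁻ x, ENNReal.ofReal (k x)) ^ 2 := by
  set S := ⨆ x, φ x with hS
  set T := ⨆ x, ψ x with hT
  have hS0 : 0 < S := by
    obtain ⟨x, hx⟩ := hφp
    exact hx.trans_le (le_ciSup hφb x)
  have hT0 : 0 < T := by
    obtain ⟨x, hx⟩ := hψp
    exact hx.trans_le (le_ciSup hψb x)
  have hR0 : 0 < √(S * T) := by positivity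
  have hR2 : √(S * T) ^ 2 = S * T := Real.sq_sqrt (by positivity)
  have key := pl_core (φ := fun x => φ x / S) (ψ := fun x => ψ x / T) (k := fun x => k x / √(S * T))
    (hφ.div_const _) (hψ.div_const _) (hk.div_const _)
    (fun x => div_nonneg (hφ0 x) hS0.le) (fun x => div_nonneg (hψ0 x) hT0.le)
    (fun x => div_nonneg (hk0 x) hR0.le)
    (fun x => (div_le_one hS0).2 (le_ciSup hφb x)) (fun x => (div_le_one hT0).2 (le_ciSup hψb x))
    (fun t ht => by
      obtain ⟨x, hx⟩ := exists_lt_of_lt_ciSup (f := φ) (b := t * S) (by nlinarith)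
      exact ⟨x, (lt_div_iff₀ hS0).2 hx⟩)
    (fun t ht => by
      obtain ⟨x, hx⟩ := exists_lt_of_lt_ciSup (f := ψ) (b := t * T) (by nlinarith)
      exact ⟨x, (lt_div_iff₀ hT0).2 hx⟩)
    (fun a b => by
      have := h a b
      rw [div_pow, hR2, div_mul_div_comm]
      gcongr)
  have conv : ∀ (u : ℝ → ℝ) (c : ℝ), 0 < c → Measurable u → (∫⁻ x, ENNReal.ofReal (u x)) =
      ENNReal.ofReal c * ∫⁻ x, ENNReal.ofReal (u x / c) := by
    intro u c hc hu
    rw [← lintegral_const_mul _ (by fun_prop)]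
    congr 1; ext x
    rw [← ENNReal.ofReal_mul hc.le]
    congr 1; field_simp
  rw [conv φ S hS0 hφ, conv ψ T hT0 hψ, conv k _ hR0 hk]
  set p := ∫⁻ x, ENNReal.ofReal (φ x / S)
  set q := ∫⁻ x, ENNReal.ofReal (ψ x / T)
  calc _ = ENNReal.ofReal S * ENNReal.ofReal T * (4 * (p * q)) := by ring
    _ ≤ ENNReal.ofReal S * ENNReal.ofReal T * (p + q) ^ 2 := by gcongr; exact ennreal_amgm p q
    _ = (ENNReal.ofReal √(S * T) * (p + q)) ^ 2 := by
        rw [mul_pow, ← ENNReal.ofReal_mul hS0.le, ← ENNReal.ofReal_pow hR0.le, hR2]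
    _ ≤ _ := by gcongr

lemma pl_ennreal {φ ψ : ℝ → ℝ≥0∞} {k : ℝ → ℝ} (hφ : Measurable φ) (hψ : Measurable ψ)
    (hk : Measurable k) (hk0 : ∀ x, 0 ≤ k x) (M : ℝ) (hkM : ∀ x, k x ≤ M)
    (h : ∀ a b, φ a * ψ b ≤ ENNReal.ofReal (k (a + b) ^ 2)) :
    4 * ((∫⁻ x, φ x) * (∫⁻ x, ψ x)) ≤ (∫⁻ x, ENNReal.ofReal (k x)) ^ 2 := by
  by_cases hφz : ∀ x, φ x = 0
  · simp [hφz]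
  by_cases hψz : ∀ x, ψ x = 0
  · simp [hψz]
  push Not at hφz hψz
  obtain ⟨a, ha⟩ := hφz
  obtain ⟨b, hb⟩ := hψz
  have hM : ∀ x y, φ x * ψ y ≤ ENNReal.ofReal (M ^ 2) := fun x y => (h x y).trans
    (ENNReal.ofReal_le_ofReal (by have := hkM (x + y); have := hk0 (x+y); gcongr))
  have bφ : ∀ x, φ x ≤ ENNReal.ofReal (M ^ 2) / ψ b := fun x =>
    ENNReal.le_div_iff_mul_le (.inl hb) (.inr (by simp)) |>.2 (hM x b)
  have bψ : ∀ x, ψ x ≤ ENNReal.ofReal (M ^ 2) / φ a := fun x =>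
    ENNReal.le_div_iff_mul_le (.inl ha) (.inr (by simp)) |>.2 (by rw [mul_comm]; exact hM a x)
  have fφ : ENNReal.ofReal (M ^ 2) / ψ b ≠ ∞ := ENNReal.div_ne_top (by simp) hb
  have fψ : ENNReal.ofReal (M ^ 2) / φ a ≠ ∞ := ENNReal.div_ne_top (by simp) ha
  have nφ : ∀ x, φ x ≠ ∞ := fun x => ne_top_of_le_ne_top fφ (bφ x)
  have nψ : ∀ x, ψ x ≠ ∞ := fun x => ne_top_of_le_ne_top fψ (bψ x)
  have := pl_real (φ := fun x => (φ x).toReal) (ψ := fun x => (ψ x).toReal) (k := k)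
    hφ.ennreal_toReal hψ.ennreal_toReal hk (by simp) (by simp) hk0
    ⟨_, by rintro _ ⟨x, rfl⟩; exact ENNReal.toReal_mono fφ (bφ x)⟩
    ⟨_, by rintro _ ⟨x, rfl⟩; exact ENNReal.toReal_mono fψ (bψ x)⟩
    ⟨a, ENNReal.toReal_pos ha (nφ a)⟩ ⟨b, ENNReal.toReal_pos hb (nψ b)⟩
    (fun x y => by
      rw [← ENNReal.toReal_mul]
      exact ENNReal.toReal_le_of_le_ofReal (by positivity) (h x y))
  simpa [ENNReal.ofReal_toReal, nφ, nψ] using this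

lemma lintegral_exp_sub (f : ℝ → ℝ≥0∞) :
    ∫⁻ s in Ioi (0:ℝ), f s = ∫⁻ a, ENNReal.ofReal (exp a) * f (exp a) := by
  have := lintegral_image_eq_lintegral_abs_deriv_mul (s := univ) (f := exp) (f' := exp)
    MeasurableSet.univ (fun x _ => (Real.hasDerivAt_exp x).hasDerivWithinAt)
    exp_injective.injOn f
  simpa [Real.range_exp] using this

lemma half_gauss : ∫⁻ u in Ioi (0:ℝ), ENNReal.ofReal (exp (-(u ^ 2) / 2)) =
    ENNReal.ofReal √(π / 2) := by
  have h := integral_gaussian_Ioi (1/2)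
  rw [← ofReal_integral_eq_lintegral_ofReal]
  · congr 1
    have e : ∀ u : ℝ, exp (-(u ^ 2) / 2) = exp (-(1/2) * u ^ 2) := fun u => by congr 1; ring
    simp only [e]
    rw [h]
    rw [show π / (1/2) = 2 ^ 2 * (π / 2) by ring, Real.sqrt_mul (by positivity),
      Real.sqrt_sq (by norm_num)]
    ring
  · have := (integrable_exp_neg_mul_sq (b := 1/2) (by norm_num)).integrableOn (s := Ioi 0)
    refine this.congr (.of_forall fun u => ?_)
    simp only; congr 1; ring
  · exact .of_forall fun x => (exp_pos _).le

lemma kernel_int : ∫⁻ c, ENNReal.ofReal (exp (c / 2) * exp (- exp c / 2)) =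
    ENNReal.ofReal (2 * √(π / 2)) := by
  rw [ENNReal.ofReal_mul (by norm_num), ← half_gauss]
  have := lintegral_image_eq_lintegral_abs_deriv_mul (s := univ) (f := fun c : ℝ => exp (c / 2))
    (f' := fun c => exp (c / 2) * (1 / 2))
    MeasurableSet.univ (fun x _ => ((hasDerivAt_id x).div_const 2).exp.hasDerivWithinAt)
    (fun x _ y _ hxy => by have := exp_injective hxy; linarith)
    (fun u => ENNReal.ofReal (exp (-(u ^ 2) / 2)))
  have hr : (fun c : ℝ => exp (c / 2)) '' univ = Ioi 0 := by
    rw [image_univ, ← Real.range_exp]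
    ext x; constructor
    · rintro ⟨y, rfl⟩; exact ⟨_, rfl⟩
    · rintro ⟨y, rfl⟩; exact ⟨2 * y, by simp⟩
  rw [hr] at this
  rw [this, ← lintegral_const_mul _ (by fun_prop)]
  simp only [Measure.restrict_univ]
  congr 1; ext c
  rw [abs_of_pos (by positivity), ← ENNReal.ofReal_mul (by positivity),
    ← ENNReal.ofReal_mul (by positivity)]
  congr 1
  rw [← Real.exp_nat_mul]
  push_cast
  rw [show 2 * (c / 2) = c by ring]
  ring

lemma one_dim {φ ψ : ℝ → ℝ≥0∞} (hφ : Measurable φ) (hψ : Measurable ψ) (C : ℝ) (hC : 0 ≤ C)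
    (h : ∀ s t, 0 < s → 0 < t → φ s * ψ t ≤ ENNReal.ofReal (C * exp (-(s * t)))) :
    (∫⁻ s in Ioi 0, φ s) * (∫⁻ t in Ioi 0, ψ t) ≤ ENNReal.ofReal (C * (π / 2)) := by
  rw [lintegral_exp_sub, lintegral_exp_sub]
  have key := pl_ennreal (φ := fun a => ENNReal.ofReal (exp a) * φ (exp a))
    (ψ := fun a => ENNReal.ofReal (exp a) * ψ (exp a))
    (k := fun c => √C * (exp (c / 2) * exp (- exp c / 2))) (by fun_prop) (by fun_prop) (by fun_prop)
    (fun x => by positivity) (√C) (fun x => by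
      have : exp (x / 2) * exp (- exp x / 2) ≤ 1 := by
        rw [← exp_add, exp_le_one_iff]
        have := Real.add_one_le_exp x
        linarith
      nlinarith [Real.sqrt_nonneg C])
    (fun a b => by
      calc _ = ENNReal.ofReal (exp a) * ENNReal.ofReal (exp b) * (φ (exp a) * ψ (exp b)) := by ring
        _ ≤ ENNReal.ofReal (exp a) * ENNReal.ofReal (exp b) *
            ENNReal.ofReal (C * exp (-(exp a * exp b))) := by
            gcongr; exact h _ _ (exp_pos _) (exp_pos _)
        _ = _ := by
          rw [← ENNReal.ofReal_mul (by positivity), ← ENNReal.ofReal_mul (by positivity)]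
          congr 1
          rw [mul_pow, Real.sq_sqrt hC, ← exp_add, ← exp_add, ← Real.exp_nat_mul]
          push_cast
          rw [show 2 * ((a + b) / 2 + -exp (a + b) / 2) = (a + b) + -exp (a + b) by ring, exp_add (a+b)]
          ring)
  have e : (∫⁻ x, ENNReal.ofReal (√C * (exp (x / 2) * exp (-exp x / 2)))) ^ 2 =
      4 * ENNReal.ofReal (C * (π / 2)) := by
    simp_rw [ENNReal.ofReal_mul (Real.sqrt_nonneg C)]
    rw [lintegral_const_mul _ (by fun_prop), kernel_int, ← ENNReal.ofReal_mul (by positivity),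
      ← ENNReal.ofReal_pow (by positivity)]
    rw [show (4 : ℝ≥0∞) = ENNReal.ofReal 4 by simp, ← ENNReal.ofReal_mul (by positivity)]
    congr 1
    rw [mul_pow, mul_pow, Real.sq_sqrt hC, Real.sq_sqrt (by positivity)]
    ring
  rw [e] at key
  exact (ENNReal.mul_le_mul_iff_right (by simp) (by simp)).1 key


def SP {V : Type*} [NormedAddCommGroup V] [NormedSpace ℝ V] [MeasurableSpace V]
    (μ : Measure V) (B : V →L[ℝ] V →L[ℝ] ℝ) (c : ℝ≥0∞) : Prop :=
  ∀ f g : V → ℝ≥0∞, Measurable f → Measurable g →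
    (∀ x y, f x * g y ≤ ENNReal.ofReal (exp (-(B x y)))) → ∫⁻ x, f x ∂μ ≠ ∞ →
    Integrable (fun x => x) (μ.withDensity f) → ∫ x, x ∂(μ.withDensity f) = 0 →
    (∫⁻ x, f x ∂μ) * (∫⁻ y, g y ∂μ) ≤ c

def SQ {V : Type*} [NormedAddCommGroup V] [NormedSpace ℝ V] [MeasurableSpace V]
    (μ : Measure V) (B : V →L[ℝ] V →L[ℝ] ℝ) (c : ℝ≥0∞) : Prop :=
  ∀ f : V → ℝ≥0∞, Measurable f → ∫⁻ x, f x ∂μ ≠ ∞ →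
    Integrable (fun x => x) (μ.withDensity f) →
    ∃ z, ∀ g : V → ℝ≥0∞, Measurable g →
      (∀ x y, f (z + x) * g y ≤ ENNReal.ofReal (exp (-(B x y)))) →
      (∫⁻ x, f x ∂μ) * (∫⁻ y, g y ∂μ) ≤ c

section
variable {V : Type*} [NormedAddCommGroup V] [NormedSpace ℝ V] [MeasurableSpace V]
  [BorelSpace V] [FiniteDimensional ℝ V] [SecondCountableTopology V]
  {μ : Measure V} [μ.IsAddHaarMeasure] {B : V →L[ℝ] V →L[ℝ] ℝ} {c : ℝ≥0∞}

lemma jensen_exp (ν : Measure V) [IsFiniteMeasure ν] (hI : Integrable (fun x => x) ν)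
    (h0 : ∫ x, x ∂ν = 0) (L : V →L[ℝ] ℝ) :
    ν univ ≤ ∫⁻ x, ENNReal.ofReal (exp (L x)) ∂ν := by
  by_cases hfin : ∫⁻ x, ENNReal.ofReal (exp (L x)) ∂ν = ∞
  · simp [hfin]
  have hIntg : Integrable (fun x => exp (L x)) ν := by
    refine ⟨by fun_prop, ?_⟩
    rw [hasFiniteIntegral_iff_ofReal (.of_forall fun x => (exp_pos _).le)]
    exact lt_top_iff_ne_top.2 hfin
  rw [← ofReal_integral_eq_lintegral_ofReal hIntg (.of_forall fun x => (exp_pos _).le)]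
  have hL : Integrable (fun x => L x) ν := L.integrable_comp hI
  have h1 : ∫ x, (L x + 1) ∂ν ≤ ∫ x, exp (L x) ∂ν :=
    integral_mono (hL.add (integrable_const _)) hIntg fun x => Real.add_one_le_exp _
  have h2 : ∫ x, (L x + 1) ∂ν = ν.real univ := by
    rw [integral_add hL (integrable_const _)]
    have := L.integral_comp_comm hI
    rw [this, h0]
    simp
  rw [h2] at h1
  calc ν univ = ENNReal.ofReal (ν.real univ) := by simp
    _ ≤ _ := ENNReal.ofReal_le_ofReal h1

lemma SQ.toSP (hQ : SQ μ B c) (hB : ∀ x y, B x y = B y x) : SP μ B c := by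
  intro f g hf hg hfg hfin hI h0
  have : ProperSpace V := FiniteDimensional.proper_real V
  by_cases hz : ∀ x, f x = 0
  · simp [hz]
  push Not at hz
  obtain ⟨x0, hx0⟩ := hz
  have key : ∀ R : ℕ, (∫⁻ x, f x ∂μ) * (∫⁻ y in closedBall 0 (R : ℝ), g y ∂μ) ≤ c := by
    intro R
    set S : Set V := closedBall 0 (R : ℝ)
    have hS : MeasurableSet S := measurableSet_closedBall
    have hSc : IsCompact S := isCompact_closedBall _ _
    set gR : V → ℝ≥0∞ := S.indicator g
    have hgR : Measurable gR := hg.indicator hS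
    have hgRint : ∫⁻ y, gR y ∂μ = ∫⁻ y in S, g y ∂μ := lintegral_indicator hS _
    obtain ⟨M, hM⟩ := hSc.exists_bound_of_continuousOn (f := fun y => exp (-(B x0 y)))
      (by fun_prop)
    have hgb : ∀ y ∈ S, g y ≤ ENNReal.ofReal M / f x0 := by
      intro y hy
      refine ENNReal.le_div_iff_mul_le (.inl hx0) (.inr (by simp)) |>.2 ?_
      rw [mul_comm]
      refine (hfg x0 y).trans (ENNReal.ofReal_le_ofReal ((le_abs_self _).trans (hM y hy)))
    have hfinR : ∫⁻ y, gR y ∂μ ≠ ∞ := by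
      rw [hgRint]
      have : ∫⁻ y in S, g y ∂μ ≤ ∫⁻ y in S, ENNReal.ofReal M / f x0 ∂μ :=
        setLIntegral_mono measurable_const hgb
      refine ne_top_of_le_ne_top ?_ this
      rw [setLIntegral_const]
      exact ENNReal.mul_ne_top (ENNReal.div_ne_top (by simp) hx0) hSc.measure_ne_top
    have : IsFiniteMeasure (μ.withDensity gR) := isFiniteMeasure_withDensity hfinR
    have hIR : Integrable (fun x => x) (μ.withDensity gR) := by
      refine Integrable.of_bound (C := (R : ℝ)) (by fun_prop) ?_
      rw [ae_withDensity_iff hgR]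
      refine .of_forall fun x hx => ?_
      have : x ∈ S := by
        by_contra h
        exact hx (indicator_of_notMem h _)
      simpa [S] using this
    obtain ⟨z, hz⟩ := hQ gR hgR hfinR hIR
    have h1 := hz (fun y => f y * ENNReal.ofReal (exp (B z y))) (by fun_prop) (by
      intro x y
      by_cases hzx : z + x ∈ S
      · simp only [gR, indicator_of_mem hzx]
        calc g (z + x) * (f y * ENNReal.ofReal (exp (B z y)))
            = f y * g (z + x) * ENNReal.ofReal (exp (B z y)) := by ring
          _ ≤ ENNReal.ofReal (exp (-(B y (z + x)))) * ENNReal.ofReal (exp (B z y)) := by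
              gcongr; exact hfg _ _
          _ = _ := by
              rw [← ENNReal.ofReal_mul (exp_pos _).le, ← exp_add]
              congr 2
              rw [map_add, hB y z, hB y x]; ring
      · simp [gR, indicator_of_notMem hzx])
    have : IsFiniteMeasure (μ.withDensity f) := isFiniteMeasure_withDensity hfin
    have h2 := jensen_exp (μ.withDensity f) hI h0 (B z)
    rw [lintegral_withDensity_eq_lintegral_mul _ hf (by fun_prop), withDensity_apply _ .univ,
      Measure.restrict_univ] at h2
    rw [hgRint] at h1
    rw [mul_comm]
    refine le_trans ?_ h1
    exact mul_le_mul_right h2 _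
  have hmono : ∫⁻ y, g y ∂μ = ⨆ R : ℕ, ∫⁻ y in closedBall 0 (R : ℝ), g y ∂μ := by
    rw [← setLIntegral_iUnion_of_directed, iUnion_closedBall_nat, Measure.restrict_univ]
    refine Monotone.directed_le fun a b hab => closedBall_subset_closedBall (by exact_mod_cast hab)
  rw [hmono, ENNReal.mul_iSup]
  exact iSup_le key

lemma subst_sigma (σ m : ℝ) (hσ : σ = 1 ∨ σ = -1) (φ : ℝ → ℝ≥0∞) :
    ∫⁻ s, φ s = ∫⁻ s, φ (m + σ * s) := by
  rcases hσ with rfl | rfl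
  · simp only [one_mul]; exact (lintegral_add_left_eq_self φ m).symm
  · have := lintegral_neg_eq_self (μ := (volume : Measure ℝ)) (fun s => φ (m + s))
    simp only [neg_mul, one_mul]
    rw [this]; exact (lintegral_add_left_eq_self φ m).symm

lemma map_density (f : ℝ × V → ℝ≥0∞) (hf : Measurable f) (m σ : ℝ) (ζ w : V)
    (hσ : σ = 1 ∨ σ = -1) :
    μ.withDensity (fun x => ∫⁻ s in Ioi 0, f (m + σ * s, ζ + x + (σ * s) • w)) =
    (((volume.prod μ).withDensity f).restrict {p | 0 < σ * (p.1 - m)}).map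
      (fun p => p.2 - ζ - (p.1 - m) • w) := by
  have hσ2 : σ * σ = 1 := by rcases hσ with rfl | rfl <;> norm_num
  ext A hA
  have hT : Measurable (fun p : ℝ × V => p.2 - ζ - (p.1 - m) • w) := by fun_prop
  have hH : MeasurableSet {p : ℝ × V | 0 < σ * (p.1 - m)} :=
    measurableSet_lt measurable_const (by fun_prop)
  rw [Measure.map_apply hT hA, Measure.restrict_apply (hT hA), withDensity_apply _ hA,
    withDensity_apply _ ((hT hA).inter hH), ← lintegral_indicator hA,
    ← lintegral_indicator ((hT hA).inter hH),
    lintegral_prod _ (hf.indicator ((hT hA).inter hH)).aemeasurable, subst_sigma σ m hσ]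
  have e1 : ∀ s, (∫⁻ x, ((fun p : ℝ × V => p.2 - ζ - (p.1 - m) • w) ⁻¹' A ∩
      {p : ℝ × V | 0 < σ * (p.1 - m)}).indicator f (m + σ * s, x) ∂μ) =
      ∫⁻ x, (Ioi (0:ℝ)).indicator (fun s => A.indicator
        (fun x => f (m + σ * s, ζ + x + (σ * s) • w)) x) s ∂μ := by
    intro s
    rw [← lintegral_add_left_eq_self _ (ζ + (σ * s) • w)]
    congr 1; ext x
    have hx : ζ + (σ * s) • w + x = ζ + x + (σ * s) • w := by abel
    rw [hx]
    have h1 : (m + σ * s, ζ + x + (σ * s) • w) ∈ ((fun p : ℝ × V => p.2 - ζ - (p.1 - m) • w) ⁻¹' A ∩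
      {p : ℝ × V | 0 < σ * (p.1 - m)}) ↔ s ∈ Ioi (0:ℝ) ∧ x ∈ A := by
      have a1 : ζ + x + (σ * s) • w - ζ - (m + σ * s - m) • w = x := by
        rw [add_sub_cancel_left]; abel
      have a2 : σ * (m + σ * s - m) = s := by rw [add_sub_cancel_left, ← mul_assoc, hσ2, one_mul]
      simp only [mem_inter_iff, mem_preimage, mem_ofPred_eq, a1, a2, mem_Ioi]
      tauto
    by_cases hs : s ∈ Ioi (0:ℝ) <;> by_cases hxA : x ∈ A <;>
      simp only [indicator, h1, hs, hxA, and_self, and_true, and_false, if_true, if_false]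
  simp_rw [e1]
  rw [lintegral_lintegral_swap]
  · congr 1; ext x
    rw [lintegral_indicator measurableSet_Ioi]
    by_cases hx : x ∈ A <;> simp [hx]
  · refine Measurable.aemeasurable ?_
    have : (Function.uncurry fun (s : ℝ) x => (Ioi (0:ℝ)).indicator (fun s => A.indicator
        (fun x => f (m + σ * s, ζ + x + (σ * s) • w)) x) s) =
        (Ioi (0:ℝ) ×ˢ A).indicator (fun p => f (m + σ * p.1, ζ + p.2 + (σ * p.1) • w)) := by
      ext ⟨s, x⟩
      by_cases hs : s ∈ Ioi (0:ℝ) <;> by_cases hxA : x ∈ A <;>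
        simp only [indicator, Function.uncurry, mem_prod, hs, hxA, and_self, and_true, and_false, if_true, if_false]
    rw [this]
    exact Measurable.indicator (by fun_prop) (measurableSet_Ioi.prod hA)

lemma half_step (hP : SP μ B c) (f g : ℝ × V → ℝ≥0∞) (hf : Measurable f) (hg : Measurable g)
    (m σ : ℝ) (ζ w : V) (hσ : σ = 1 ∨ σ = -1)
    (hfg : ∀ p q, f ((m, ζ) + p) * g q ≤ ENNReal.ofReal (exp (-(p.1 * q.1 + B p.2 q.2))))
    (hfin : ∫⁻ p, f p ∂(volume.prod μ) ≠ ∞)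
    (hI : Integrable (fun p => p) ((volume.prod μ).withDensity f))
    (hbar : ∫ p in {p : ℝ × V | 0 < σ * (p.1 - m)}, (p.2 - ζ - (p.1 - m) • w)
      ∂((volume.prod μ).withDensity f) = 0) :
    (volume.prod μ).withDensity f {p : ℝ × V | 0 < σ * (p.1 - m)} *
      (∫⁻ y, (∫⁻ t in Ioi (0:ℝ), g (σ * t - B w y, y)) ∂μ) ≤ c * ENNReal.ofReal (π / 2) := by
  have hσ2 : σ * σ = 1 := by rcases hσ with rfl | rfl <;> norm_num
  have hmap := map_density (μ := μ) f hf m σ ζ w hσ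
  set F : V → ℝ≥0∞ := fun x => ∫⁻ s in Ioi 0, f (m + σ * s, ζ + x + (σ * s) • w) with hF
  set G : V → ℝ≥0∞ := fun y => ∫⁻ t in Ioi (0:ℝ), g (σ * t - B w y, y) with hG
  set ν := (volume.prod μ).withDensity f with hν
  have : IsFiniteMeasure ν := isFiniteMeasure_withDensity hfin
  have hT : Measurable (fun p : ℝ × V => p.2 - ζ - (p.1 - m) • w) := by fun_prop
  have hFm : Measurable F := by
    refine Measurable.lintegral_prod_right' (f := fun p : V × ℝ => f (m + σ * p.2, ζ + p.1 + (σ * p.2) • w)) ?_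
    fun_prop
  have hGm : Measurable G := by
    refine Measurable.lintegral_prod_right' (f := fun p : V × ℝ => g (σ * p.2 - B w p.1, p.1)) ?_
    fun_prop
  have hFint : ∫⁻ x, F x ∂μ = ν {p : ℝ × V | 0 < σ * (p.1 - m)} := by
    have := congrArg (fun ρ => ρ univ) hmap
    simp only [withDensity_apply _ MeasurableSet.univ, Measure.map_apply hT .univ, 
      Measure.restrict_univ, preimage_univ, Measure.restrict_apply_univ] at this
    exact this
  have hTI : Integrable (fun p : ℝ × V => p.2 - ζ - (p.1 - m) • w) ν := by
    have h1 : Integrable (fun p : ℝ × V => p.1) ν := hI.fst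
    have h2 : Integrable (fun p : ℝ × V => p.2) ν := hI.snd
    exact (h2.sub (integrable_const _)).sub ((h1.sub (integrable_const _)).smul_const w)
  have hpi : (0 : ℝ) < π / 2 := by positivity
  have key := hP F (fun y => (ENNReal.ofReal (π / 2))⁻¹ * G y) hFm (by fun_prop) (by
      intro x y
      have h1 := one_dim (φ := fun s => f (m + σ * s, ζ + x + (σ * s) • w))
        (ψ := fun t => g (σ * t - B w y, y)) (by fun_prop) (by fun_prop) (exp (-(B x y)))
        (exp_pos _).le (by
          intro s t _ _
          have := hfg (σ * s, x + (σ * s) • w) (σ * t - B w y, y)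
          simp only [Prod.mk_add_mk, ← add_assoc] at this
          refine this.trans (le_of_eq ?_)
          rw [← exp_add]
          congr 2
          simp only [map_add, map_smul, add_apply,
            smul_apply, smul_eq_mul]
          linear_combination (- s * t) * hσ2)
      rw [mul_left_comm, mul_comm, ← div_eq_mul_inv]
      refine ENNReal.div_le_of_le_mul ?_
      rw [← ENNReal.ofReal_mul (exp_pos _).le]
      exact h1)
    (by rw [hFint]; exact measure_ne_top _ _)
    (by
      rw [hmap, integrable_map_measure (by fun_prop) hT.aemeasurable]
      exact hTI.integrableOn)
    (by
      rw [hmap, integral_map hT.aemeasurable (by fun_prop)]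
      exact hbar)
  rw [lintegral_const_mul _ hGm, hFint, mul_left_comm, mul_comm, ← div_eq_mul_inv] at key
  exact (ENNReal.div_le_iff_le_mul (.inl (by simpa using hpi)) (.inl (by simp))).1 key
end


lemma exists_median (ρ : Measure ℝ) [IsFiniteMeasure ρ] [NullSingletonClass ρ] :
    ∃ m, ρ (Ioi m) = ρ (Iio m) := by
  by_cases hρ : ρ univ = 0
  · rw [Measure.measure_univ_eq_zero] at hρ
    simp [hρ]
  have hM : 0 < ρ.real univ := by
    rw [measureReal_def]; exact ENNReal.toReal_pos hρ (measure_ne_top _ _)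
  have hc : Continuous (fun t => ρ.real (Iic t)) := by
    have h1 := intervalIntegral.continuous_primitive (μ := ρ) (f := fun _ => (1:ℝ))
      (fun a b => intervalIntegrable_const) 0
    have h2 : (fun t => ρ.real (Iic t)) = fun t => ρ.real (Iic 0) + ∫ x in (0:ℝ)..t, (1:ℝ) ∂ρ := by
      ext t
      rw [← intervalIntegral.integral_Iic_sub_Iic (by simp) (by simp)]
      simp
    rw [h2]; fun_prop
  have hbot : Filter.Tendsto (fun t => ρ.real (Iic t)) Filter.atBot (nhds 0) := by
    have h1 := (ENNReal.tendsto_toReal (measure_ne_top ρ univ)).comp (tendsto_measure_Ici_atBot ρ)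
    have h2 := h1.const_sub (ρ.real univ)
    have h3 : (ρ univ).toReal = ρ.real univ := rfl
    rw [h3, sub_self] at h2
    refine h2.congr fun t => ?_
    have h4 : ρ.real (Iic t) = ρ.real (Iio t) := by
      rw [measureReal_def, measureReal_def, measure_congr (Iio_ae_eq_Iic (a := t) (μ := ρ))]
    rw [h4, ← compl_Ici, measureReal_compl measurableSet_Ici]
    rfl
  have htop : Filter.Tendsto (fun t => ρ.real (Iic t)) Filter.atTop (nhds (ρ.real univ)) := by
    have := tendsto_measure_Iic_atTop ρ
    exact (ENNReal.tendsto_toReal (by simp)).comp this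
  obtain ⟨a, ha⟩ := (hbot.eventually_le_const (u := ρ.real univ / 2) (by positivity)).exists
  obtain ⟨b, hb⟩ := (htop.eventually_const_le (u := ρ.real univ / 2) (by linarith)).exists
  obtain ⟨m, hm⟩ := mem_range_of_exists_le_of_exists_ge hc ⟨a, ha⟩ ⟨b, hb⟩
  refine ⟨m, ?_⟩
  rw [measure_congr (Iio_ae_eq_Iic (a := m) (μ := ρ)), ← compl_Iic,
    measure_compl measurableSet_Iic (measure_ne_top _ _)]
  have h3 : ρ univ = ENNReal.ofReal (ρ.real univ) := by simp
  have h4 : ρ (Iic m) = ENNReal.ofReal (ρ.real (Iic m)) := by simp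
  rw [h3, h4, ← ENNReal.ofReal_sub _ (by positivity)]
  congr 1
  simp only at hm
  linarith

lemma split_line (h : ℝ → ℝ≥0∞) (b : ℝ) :
    ∫⁻ t, h t = (∫⁻ t in Ioi (0:ℝ), h (1 * t - b)) + ∫⁻ t in Ioi (0:ℝ), h (-1 * t - b) := by
  have e : ∀ φ : ℝ → ℝ≥0∞, ∫⁻ t in Ioi (0:ℝ), φ (-1 * t) = ∫⁻ t in Iio (0:ℝ), φ t := by
    intro φ
    rw [← lintegral_indicator measurableSet_Ioi, ← lintegral_indicator measurableSet_Iio,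
      ← lintegral_neg_eq_self]
    congr 1; ext t
    by_cases ht : t < 0 <;> simp [indicator, ht]
  rw [e (fun t => h (t - b))]
  simp only [one_mul]
  have h1 : ∫⁻ t in Iio (0:ℝ), h (t - b) = ∫⁻ t in (Ioi (0:ℝ))ᶜ, h (t - b) := by
    rw [compl_Ioi]
    exact setLIntegral_congr Iio_ae_eq_Iic
  rw [h1, lintegral_add_compl _ measurableSet_Ioi, lintegral_sub_right_eq_self]

section
variable {V : Type*} [NormedAddCommGroup V] [NormedSpace ℝ V] [MeasurableSpace V]
  [BorelSpace V] [FiniteDimensional ℝ V] [SecondCountableTopology V]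
  {μ : Measure V} [μ.IsAddHaarMeasure] {B : V →L[ℝ] V →L[ℝ] ℝ} {c : ℝ≥0∞}

/-- The pairing on `ℝ × V`. -/
def extB (B : V →L[ℝ] V →L[ℝ] ℝ) : (ℝ × V) →L[ℝ] (ℝ × V) →L[ℝ] ℝ :=
  (ContinuousLinearMap.mul ℝ ℝ).bilinearComp (ContinuousLinearMap.fst ℝ ℝ V)
    (ContinuousLinearMap.fst ℝ ℝ V) +
  B.bilinearComp (ContinuousLinearMap.snd ℝ ℝ V) (ContinuousLinearMap.snd ℝ ℝ V)

lemma extB_apply (p q : ℝ × V) : extB B p q = p.1 * q.1 + B p.2 q.2 := by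
  simp [extB]

lemma step (hP : SP μ B c) : SQ (volume.prod μ) (extB B) (c * ENNReal.ofReal (2 * π)) := by
  intro f hf hfin hI
  by_cases hz : ∫⁻ x, f x ∂(volume.prod μ) = 0
  · exact ⟨0, fun g _ _ => by simp [hz]⟩
  set ν := (volume.prod μ).withDensity f with hν
  have hfinν : IsFiniteMeasure ν := isFiniteMeasure_withDensity hfin
  have hνu : ν univ = ∫⁻ x, f x ∂(volume.prod μ) := by
    rw [hν, withDensity_apply _ .univ, Measure.restrict_univ]
  have hatom : ∀ a : ℝ, ν (Prod.fst ⁻¹' {a}) = 0 := by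
    intro a
    refine withDensity_absolutelyContinuous _ _ ?_
    rw [← Set.prod_univ, Measure.prod_prod]
    simp
  have : NullSingletonClass (ν.map Prod.fst) := ⟨fun a => by
    rw [Measure.map_apply measurable_fst (measurableSet_singleton a)]; exact hatom a⟩
  obtain ⟨m, hm⟩ := exists_median (ν.map Prod.fst)
  rw [Measure.map_apply measurable_fst measurableSet_Ioi,
    Measure.map_apply measurable_fst measurableSet_Iio] at hm
  set Hp : Set (ℝ × V) := {p | 0 < 1 * (p.1 - m)} with hHp
  set Hm : Set (ℝ × V) := {p | 0 < -1 * (p.1 - m)} with hHm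
  have eHp : Prod.fst ⁻¹' Ioi m = Hp := by
    ext p; simp [Hp]
  have eHm : Prod.fst ⁻¹' Iio m = Hm := by
    ext p; simp [Hm]
  have mHp : MeasurableSet Hp := eHp ▸ measurable_fst measurableSet_Ioi
  have mHm : MeasurableSet Hm := eHm ▸ measurable_fst measurableSet_Iio
  rw [eHp, eHm] at hm
  have hsum : ν univ = ν Hp + ν Hm := by
    rw [← measure_add_measure_compl mHp]
    congr 1
    apply measure_congr
    have : Hpᶜ = Hm ∪ Prod.fst ⁻¹' {m} := by
      ext p
      simp only [Hp, Hm, mem_compl_iff, mem_ofPred_eq, mem_union, mem_preimage, mem_singleton_iff]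
      constructor
      · intro h
        rcases lt_or_eq_of_le (show p.1 ≤ m by linarith) with h | h
        · left; linarith
        · right; exact h
      · rintro (h | h) <;> linarith
    rw [this]
    exact union_ae_eq_left_of_ae_eq_empty (ae_eq_empty.2 (hatom m))
  have hνp : ν Hp ≠ 0 := by
    intro h0
    rw [← hm, h0] at hsum
    exact hz (by rw [← hνu, hsum]; simp)
  have hI1 : Integrable (fun p : ℝ × V => p.1 - m) ν := hI.fst.sub (integrable_const _)
  have hI2 : Integrable (fun p : ℝ × V => p.2) ν := hI.snd
  set M := ν.real Hp with hM
  have hMm : ν.real Hm = M := by rw [hM, measureReal_def, measureReal_def, hm]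
  have hM0 : 0 < M := ENNReal.toReal_pos hνp (measure_ne_top _ _)
  set Ip := ∫ p in Hp, (p.1 - m) ∂ν with hIp
  set Im := ∫ p in Hm, (p.1 - m) ∂ν with hIm
  set Xp := ∫ p in Hp, p.2 ∂ν with hXp
  set Xm := ∫ p in Hm, p.2 ∂ν with hXm
  have hIp0 : 0 < Ip := by
    rw [hIp, setIntegral_pos_iff_support_of_nonneg_ae _ hI1.integrableOn]
    · have : Function.support (fun p : ℝ × V => p.1 - m) ∩ Hp = Hp := by
        refine inter_eq_right.2 fun p hp => ?_
        have hp' : 0 < 1 * (p.1 - m) := hp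
        simp only [Function.mem_support]; linarith
      rw [this]; exact pos_iff_ne_zero.2 hνp
    · refine (ae_restrict_iff' mHp).2 (.of_forall fun p hp => ?_)
      have hp' : 0 < 1 * (p.1 - m) := hp
      simp only [Pi.zero_apply]; linarith
  have hIm0 : Im ≤ 0 := by
    refine setIntegral_nonpos mHm fun p hp => ?_
    have hp' : 0 < -1 * (p.1 - m) := hp
    linarith
  set w := (Ip - Im)⁻¹ • (Xp - Xm) with hw
  set ζ := M⁻¹ • (Xp - Ip • w) with hζ
  have hMζ : M • ζ = Xp - Ip • w := by rw [hζ, smul_inv_smul₀ hM0.ne']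
  have hwI : (Ip - Im) • w = Xp - Xm := by rw [hw, smul_inv_smul₀ (by linarith)]
  have gen : ∀ H : Set (ℝ × V), ∫ p in H, (p.2 - ζ - (p.1 - m) • w) ∂ν =
      (∫ p in H, p.2 ∂ν) - ν.real H • ζ - (∫ p in H, (p.1 - m) ∂ν) • w := by
    intro H
    have hs : IntegrableOn (fun p : ℝ × V => p.2 - ζ) H ν :=
      (hI2.sub (integrable_const _)).integrableOn
    rw [integral_sub hs (hI1.integrableOn.smul_const w),
      integral_sub hI2.integrableOn (integrable_const _), setIntegral_const,
      integral_smul_const (μ := ν.restrict H) (fun p : ℝ × V => p.1 - m) w]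
  have hbp : ∫ p in Hp, (p.2 - ζ - (p.1 - m) • w) ∂ν = 0 := by
    rw [gen, ← hM, hMζ, ← hIp, ← hXp]; abel
  have hbm : ∫ p in Hm, (p.2 - ζ - (p.1 - m) • w) ∂ν = 0 := by
    rw [gen, hMm, hMζ, ← hIm, ← hXm]
    have : Xm = Xp - (Ip - Im) • w := by rw [hwI]; abel
    rw [this, sub_smul]; abel
  refine ⟨(m, ζ), fun g hg hfg => ?_⟩
  simp only [extB_apply] at hfg
  have k1 := half_step hP f g hf hg m 1 ζ w (.inl rfl) hfg hfin hI hbp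
  have k2 := half_step hP f g hf hg m (-1) ζ w (.inr rfl) hfg hfin hI hbm
  have hgsum : ∫⁻ q, g q ∂(volume.prod μ) =
      (∫⁻ y, (∫⁻ t in Ioi (0:ℝ), g (1 * t - B w y, y)) ∂μ) +
      (∫⁻ y, (∫⁻ t in Ioi (0:ℝ), g (-1 * t - B w y, y)) ∂μ) := by
    rw [lintegral_prod_symm _ hg.aemeasurable, ← lintegral_add_left]
    · congr 1; ext y
      exact split_line (fun t => g (t, y)) (B w y)
    · refine Measurable.lintegral_prod_right' (f := fun p : V × ℝ => g (1 * p.2 - B w p.1, p.1)) ?_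
      fun_prop
  rw [← hνu, hsum, hgsum, ← hm]
  rw [← hν, ← hHm, ← hm] at k2
  rw [← hν, ← hHp] at k1
  set P := ∫⁻ y, (∫⁻ t in Ioi (0:ℝ), g (1 * t - B w y, y)) ∂μ
  set Q := ∫⁻ y, (∫⁻ t in Ioi (0:ℝ), g (-1 * t - B w y, y)) ∂μ
  calc _ = (ν Hp * P + ν Hp * Q) * 2 := by ring
    _ ≤ (c * ENNReal.ofReal (π / 2) + c * ENNReal.ofReal (π / 2)) * 2 := by gcongr
    _ = c * (4 * ENNReal.ofReal (π / 2)) := by ring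
    _ = _ := by
      rw [show (4 : ℝ≥0∞) = ENNReal.ofReal 4 by simp, ← ENNReal.ofReal_mul (by positivity)]
      congr 2; ring
end

lemma SP.transport {V W : Type*} [NormedAddCommGroup V] [NormedSpace ℝ V] [MeasurableSpace V]
    [BorelSpace V] [FiniteDimensional ℝ V] [SecondCountableTopology V]
    [NormedAddCommGroup W] [NormedSpace ℝ W] [MeasurableSpace W]
    [BorelSpace W] [FiniteDimensional ℝ W] [SecondCountableTopology W]
    {μ : Measure V} {μ' : Measure W} {B : V →L[ℝ] V →L[ℝ] ℝ} {B' : W →L[ℝ] W →L[ℝ] ℝ} {c : ℝ≥0∞}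
    (hP : SP μ B c) (e : V ≃L[ℝ] W) (he : MeasurePreserving e μ μ')
    (hB : ∀ x y, B' (e x) (e y) = B x y) : SP μ' B' c := by
  intro f g hf hg hfg hfin hI h0
  have hem : Measurable e := he.measurable
  have hmap : μ'.withDensity f = (μ.withDensity (f ∘ e)).map e := by
    ext A hA
    rw [Measure.map_apply hem hA, withDensity_apply _ hA, withDensity_apply _ (hem hA),
      ← he.setLIntegral_comp_preimage hA hf]
    rfl
  rw [hmap] at hI h0
  rw [integrable_map_measure (by fun_prop) hem.aemeasurable] at hI
  rw [integral_map hem.aemeasurable (by fun_prop)] at h0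
  have hI' : Integrable (fun x => x) (μ.withDensity (f ∘ e)) := by
    have := (e.symm : W →L[ℝ] V).integrable_comp hI
    simpa using this
  rw [← he.lintegral_comp hf, ← he.lintegral_comp hg]
  refine hP (f ∘ e) (g ∘ e) (hf.comp hem) (hg.comp hem) (fun x y => ?_) ?_ hI' ?_
  · rw [← hB]; exact hfg _ _
  · rw [← he.lintegral_comp hf] at hfin; exact hfin
  · have := (e : V →L[ℝ] W).integral_comp_comm hI'
    have h1 : e (∫ x, x ∂(μ.withDensity (f ∘ e))) = 0 := by
      rw [← h0]; exact this.symm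
    simpa using h1

/-- The dot product as a continuous bilinear map. -/
def dotB (n : ℕ) : (Fin n → ℝ) →L[ℝ] (Fin n → ℝ) →L[ℝ] ℝ :=
  ∑ i, (ContinuousLinearMap.mul ℝ ℝ).bilinearComp (ContinuousLinearMap.proj i)
    (ContinuousLinearMap.proj i)

lemma dotB_apply (n : ℕ) (x y : Fin n → ℝ) : dotB n x y = ∑ i, x i * y i := by
  simp [dotB]

lemma SP_fin (n : ℕ) : SP (volume : Measure (Fin n → ℝ)) (dotB n) (ENNReal.ofReal (2 * π) ^ n) := by
  induction n with
  | zero =>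
    intro f g hf hg hfg _ _ _
    have h := hfg 0 0
    have e : ∀ h : (Fin 0 → ℝ) → ℝ≥0∞, ∫⁻ x, h x = h 0 := by
      intro h
      rw [lintegral_unique]
      have : (volume : Measure (Fin 0 → ℝ)) univ = 1 := by
        rw [← Set.pi_univ univ, volume_pi_pi]; simp
      rw [this, mul_one]
      congr 1
      exact Subsingleton.elim _ _
    rw [e, e]
    have e0 : dotB 0 0 0 = 0 := by rw [dotB_apply]; simp
    rw [e0] at h
    simpa only [neg_zero, exp_zero, ENNReal.ofReal_one, pow_zero] using h
  | succ n ih =>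
    have hQ := step ih
    have hP := hQ.toSP (fun p q => by
      simp only [extB_apply, dotB_apply]
      rw [mul_comm]; congr 1
      exact Finset.sum_congr rfl fun i _ => mul_comm _ _)
    rw [pow_succ]
    let e : (ℝ × (Fin n → ℝ)) ≃L[ℝ] (Fin (n + 1) → ℝ) :=
      (Fin.consLinearEquiv ℝ (fun _ => ℝ)).toContinuousLinearEquiv
    refine hP.transport e ?_ ?_
    · have := (volume_preserving_piFinSuccAbove (fun _ : Fin (n + 1) => ℝ) 0).symm
      have he : (e : ℝ × (Fin n → ℝ) → (Fin (n + 1) → ℝ)) =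
          (MeasurableEquiv.piFinSuccAbove (fun _ : Fin (n + 1) => ℝ) 0).symm := by
        ext p i
        refine Fin.cases ?_ (fun j => ?_) i
        · rfl
        · rfl
      rw [he]
      exact this
    · intro p q
      rw [dotB_apply, extB_apply, dotB_apply, Fin.sum_univ_succ]
      rfl

lemma SP_euclid (n : ℕ) : SP (volume : Measure (EuclideanSpace ℝ (Fin n))) (innerSL ℝ)
    (ENNReal.ofReal (2 * π) ^ n) := by
  refine (SP_fin n).transport (EuclideanSpace.equiv (Fin n) ℝ).symm ?_ ?_
  · exact PiLp.volume_preserving_toLp (Fin n)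
  · intro x y
    rw [dotB_apply, innerSL_apply_apply, PiLp.inner_apply]
    refine Finset.sum_congr rfl fun i _ => ?_
    simp [mul_comm]


section
variable {E : Type*} [NormedAddCommGroup E] [NormedSpace ℝ E] [MeasurableSpace E] [BorelSpace E]
  [FiniteDimensional ℝ E] [Nontrivial E] (μ : Measure E) [μ.IsAddHaarMeasure]

lemma lintegral_polar (F : E → ℝ≥0∞) (hF : Measurable F) :
    ∫⁻ x, F x ∂μ = ∫⁻ u : sphere (0:E) 1, (∫⁻ r in Ioi (0:ℝ),
      ENNReal.ofReal (r ^ (Module.finrank ℝ E - 1)) * F (r • (u : E))) ∂μ.toSphere := by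
  have hmp := μ.measurePreserving_homeomorphUnitSphereProd
  have e1 : ∫⁻ x, F x ∂μ = ∫⁻ x : ({(0)}ᶜ : Set E), F x ∂(μ.comap (↑)) := by
    rw [lintegral_subtype_comap (measurableSet_singleton _).compl, restrict_compl_singleton]
  have hFm : Measurable (fun q : sphere (0:E) 1 × Ioi (0:ℝ) => F ((q.2 : ℝ) • (q.1 : E))) := by
    fun_prop
  have e2 : ∫⁻ x : ({(0)}ᶜ : Set E), F x ∂(μ.comap (↑)) =
      ∫⁻ q, F ((q.2 : ℝ) • (q.1 : E)) ∂(μ.toSphere.prod (.volumeIoiPow (Module.finrank ℝ E - 1))) := by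
    rw [← hmp.lintegral_comp hFm]
    refine lintegral_congr fun x => ?_
    congr 1
    have hx : ‖(x : E)‖ ≠ 0 := norm_ne_zero_iff.2 x.2
    simp [smul_smul, hx]
  rw [e1, e2, lintegral_prod _ hFm.aemeasurable]
  refine lintegral_congr fun u => ?_
  rw [Measure.volumeIoiPow, lintegral_withDensity_eq_lintegral_mul _ (by fun_prop) (by fun_prop)]
  exact lintegral_subtype_comap measurableSet_Ioi
    (fun r : ℝ => ENNReal.ofReal (r ^ (Module.finrank ℝ E - 1)) * F (r • (u : E)))

lemma scale_line (N : ℝ) (hN : 0 < N) (ψ : ℝ → ℝ≥0∞) :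
    ∫⁻ s in Ioi (0:ℝ), ψ s = ENNReal.ofReal N * ∫⁻ r in Ioi (0:ℝ), ψ (N * r) := by
  have h := lintegral_image_eq_lintegral_abs_deriv_mul (s := Ioi (0:ℝ)) (f := fun r => N * r)
    (f' := fun _ => N) measurableSet_Ioi
    (fun x _ => by simpa using ((hasDerivAt_id x).const_mul N).hasDerivWithinAt)
    (fun x _ y _ hxy => mul_left_cancel₀ hN.ne' hxy) ψ
  have hi : (fun r => N * r) '' Ioi (0:ℝ) = Ioi 0 := by
    ext x; constructor
    · rintro ⟨y, hy, rfl⟩; exact mul_pos hN hy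
    · intro hx; exact ⟨x / N, div_pos hx hN, by field_simp⟩
  rw [hi] at h
  rw [h, abs_of_pos hN, lintegral_const_mul' _ _ (by simp)]

/-- Radial moment. -/
def Jm (d k : ℕ) (Φ : ℝ → ℝ≥0∞) : ℝ≥0∞ :=
  ∫⁻ r in Ioi (0:ℝ), ENNReal.ofReal (r ^ (d - 1 + k)) * Φ r

lemma polar_hom (N : E → ℝ) (hN : Measurable N) (hNh : ∀ r x, 0 < r → N (r • x) = r * N x)
    (hNp : ∀ x, x ≠ 0 → 0 < N x) (k : ℕ) (w : E → ℝ≥0∞) (hw : Measurable w)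
    (hwh : ∀ r x, 0 < r → w (r • x) = ENNReal.ofReal (r ^ k) * w x) (Φ : ℝ → ℝ≥0∞)
    (hΦ : Measurable Φ) :
    ∫⁻ x, w x * Φ (N x) ∂μ = (∫⁻ u : sphere (0:E) 1,
      w u * ENNReal.ofReal ((N u)⁻¹ ^ (Module.finrank ℝ E + k)) ∂μ.toSphere) *
      Jm (Module.finrank ℝ E) k Φ := by
  rw [lintegral_polar μ _ (by fun_prop), ← lintegral_mul_const _ (by fun_prop)]
  refine lintegral_congr fun u => ?_
  set d := Module.finrank ℝ E with hd
  have hd0 : 0 < d := Module.finrank_pos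
  have hu : 0 < N u := hNp u (by
    intro h
    have := u.2
    rw [h] at this
    simp at this)
  have e1 : ∫⁻ r in Ioi (0:ℝ), ENNReal.ofReal (r ^ (d - 1)) * (w (r • (u : E)) * Φ (N (r • (u:E)))) =
      ∫⁻ r in Ioi (0:ℝ), w u * (ENNReal.ofReal (r ^ (d - 1 + k)) * Φ (N u * r)) := by
    refine setLIntegral_congr_fun measurableSet_Ioi fun r (hr : 0 < r) => ?_
    rw [hwh r _ hr, hNh r _ hr, pow_add, ENNReal.ofReal_mul (by positivity), mul_comm r]
    ring
  rw [e1, lintegral_const_mul _ (by fun_prop), mul_assoc]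
  congr 1
  rw [Jm, scale_line (N u) hu (fun s => ENNReal.ofReal (s ^ (d - 1 + k)) * Φ s)]
  have e2 : ∫⁻ r in Ioi (0:ℝ), ENNReal.ofReal ((N u * r) ^ (d - 1 + k)) * Φ (N u * r) =
      ENNReal.ofReal (N u ^ (d - 1 + k)) *
        ∫⁻ r in Ioi (0:ℝ), ENNReal.ofReal (r ^ (d - 1 + k)) * Φ (N u * r) := by
    rw [← lintegral_const_mul _ (by fun_prop)]
    refine lintegral_congr fun r => ?_
    rw [mul_pow, ENNReal.ofReal_mul (by positivity)]
    ring
  rw [e2, ← mul_assoc, ← mul_assoc, ← ENNReal.ofReal_mul (by positivity),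
    ← ENNReal.ofReal_mul (by positivity)]
  have : (N ↑u)⁻¹ ^ (d + k) * N ↑u * N ↑u ^ (d - 1 + k) = 1 := by
    have : d + k = (d - 1 + k) + 1 := by omega
    rw [this, mul_assoc, ← pow_succ', ← mul_pow, inv_mul_cancel₀ hu.ne', one_pow]
  rw [this]
  simp
end

/-- Gaussian profile. -/
def gs (r : ℝ) : ℝ≥0∞ := ENNReal.ofReal (exp (-(r ^ 2) / 2))
/-- Ball profile. -/
def bs (r : ℝ) : ℝ≥0∞ := (Iic (1:ℝ)).indicator 1 r

lemma gs_meas : Measurable gs := by unfold gs; fun_prop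
lemma bs_meas : Measurable bs := measurable_one.indicator measurableSet_Iic

lemma Jm_gs_ne_top (d k : ℕ) : Jm d k gs ≠ ∞ := by
  have h := integrableOn_rpow_mul_exp_neg_mul_sq (b := 1/2) (by norm_num)
    (s := ((d - 1 + k : ℕ) : ℝ)) (by have : (0:ℝ) ≤ ((d - 1 + k : ℕ) : ℝ) := by positivity
                                     linarith)
  have h2 := h.lintegral_lt_top
  refine ne_of_lt (lt_of_le_of_lt (le_of_eq ?_) h2)
  unfold Jm gs
  refine setLIntegral_congr_fun measurableSet_Ioi fun r (hr : 0 < r) => ?_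
  rw [← ENNReal.ofReal_mul (by positivity), rpow_natCast]
  congr 3; ring

lemma Jm_gs_ne_zero (d k : ℕ) : Jm d k gs ≠ 0 := by
  unfold Jm gs
  intro h
  rw [lintegral_eq_zero_iff (by fun_prop), Filter.EventuallyEq, ae_restrict_iff' measurableSet_Ioi] at h
  have : volume (Ioi (0:ℝ)) = 0 := by
    refine measure_mono_null ?_ h
    intro r (hr : 0 < r) hc
    have := hc hr
    simp only [Pi.zero_apply, mul_eq_zero, ENNReal.ofReal_eq_zero] at this
    rcases this with h | h
    · have : 0 < r ^ (d - 1 + k) := by positivity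
      linarith
    · have := exp_pos (-(r ^ 2) / 2)
      linarith
  simp at this

lemma Jm_bs (d k : ℕ) : Jm d k bs ≠ 0 ∧ Jm d k bs ≠ ∞ := by
  have e : Jm d k bs = ∫⁻ r in Ioc (0:ℝ) 1, ENNReal.ofReal (r ^ (d - 1 + k)) := by
    unfold Jm bs
    rw [← lintegral_indicator measurableSet_Ioi, ← lintegral_indicator measurableSet_Ioc]
    refine lintegral_congr fun r => ?_
    by_cases h1 : 0 < r <;> by_cases h2 : r ≤ 1 <;> simp [indicator, h1, h2]
  rw [e]
  constructor
  · intro h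
    rw [lintegral_eq_zero_iff (by fun_prop), Filter.EventuallyEq, ae_restrict_iff' measurableSet_Ioc] at h
    have : volume (Ioc (0:ℝ) 1) = 0 := by
      refine measure_mono_null ?_ h
      intro r hr hc
      have h3 := hc hr
      have hr0 : 0 < r := hr.1
      simp only [Pi.zero_apply, ENNReal.ofReal_eq_zero] at h3
      have : 0 < r ^ (d - 1 + k) := by positivity
      linarith
    simp at this
  · have : ∫⁻ r in Ioc (0:ℝ) 1, ENNReal.ofReal (r ^ (d - 1 + k)) ≤ ∫⁻ r in Ioc (0:ℝ) 1, 1 := by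
      refine setLIntegral_mono measurable_const fun r hr => ?_
      rw [ENNReal.ofReal_le_one]
      exact pow_le_one₀ hr.1.le hr.2
    refine ne_top_of_le_ne_top ?_ this
    simp

section
variable {E : Type*} [NormedAddCommGroup E] [NormedSpace ℝ E] [MeasurableSpace E] [BorelSpace E]
  [FiniteDimensional ℝ E] [Nontrivial E] (μ : Measure E) [μ.IsAddHaarMeasure]

/-- Ratio of radial moments. -/
def kap (d k : ℕ) : ℝ≥0∞ := Jm d k gs / Jm d k bs

lemma kap_ne_top (d k : ℕ) : kap d k ≠ ∞ := ENNReal.div_ne_top (Jm_gs_ne_top d k) (Jm_bs d k).1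

lemma gauss_eq_kap (N : E → ℝ) (hN : Measurable N) (hNh : ∀ r x, 0 < r → N (r • x) = r * N x)
    (hNp : ∀ x, x ≠ 0 → 0 < N x) (k : ℕ) (w : E → ℝ≥0∞) (hw : Measurable w)
    (hwh : ∀ r x, 0 < r → w (r • x) = ENNReal.ofReal (r ^ k) * w x)
    (L : Set E) (hL : MeasurableSet L) (hNL : ∀ x, N x ≤ 1 ↔ x ∈ L) :
    ∫⁻ x, w x * gs (N x) ∂μ = kap (Module.finrank ℝ E) k * ∫⁻ x in L, w x ∂μ := by
  have e : ∫⁻ x in L, w x ∂μ = ∫⁻ x, w x * bs (N x) ∂μ := by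
    rw [← lintegral_indicator hL]
    refine lintegral_congr fun x => ?_
    by_cases hx : x ∈ L
    · have := (hNL x).2 hx
      simp [hx, bs, this]
    · have := mt (hNL x).1 hx
      simp [hx, bs, this]
  rw [e, polar_hom μ N hN hNh hNp k w hw hwh gs gs_meas,
    polar_hom μ N hN hNh hNp k w hw hwh bs bs_meas, kap, mul_left_comm, 
    ENNReal.div_mul_cancel (Jm_bs _ k).1 (Jm_bs _ k).2]
end


section
variable {n : ℕ} {K : Set (EuclideanSpace ℝ (Fin n))}

lemma supp_cont (hK : IsCompact K) : Continuous (supp K) := by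
  unfold supp
  exact hK.continuous_sSup (f := fun u x => ⟪x, u⟫) (by
    simp only [Function.HasUncurry.uncurry, id]
    fun_prop)

lemma supp_le (hK : IsCompact K) {x : EuclideanSpace ℝ (Fin n)} (hx : x ∈ K)
    (u : EuclideanSpace ℝ (Fin n)) : ⟪x, u⟫ ≤ supp K u := by
  unfold supp
  exact le_csSup (hK.image (by fun_prop)).bddAbove ⟨x, hx, rfl⟩

lemma supp_attained (hK : IsCompact K) (hne : K.Nonempty) (u : EuclideanSpace ℝ (Fin n)) :
    ∃ x ∈ K, supp K u = ⟪x, u⟫ := by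
  obtain ⟨x, hx, h⟩ := (hK.image (f := fun x => ⟪x, u⟫) (by fun_prop)).sSup_mem (hne.image _)
  exact ⟨x, hx, h.symm⟩

lemma supp_smul (hK : IsCompact K) (hne : K.Nonempty) {r : ℝ} (hr : 0 < r)
    (u : EuclideanSpace ℝ (Fin n)) : supp K (r • u) = r * supp K u := by
  apply le_antisymm
  · obtain ⟨x, hx, h⟩ := supp_attained hK hne (r • u)
    rw [h, inner_smul_right]
    exact mul_le_mul_of_nonneg_left (supp_le hK hx u) hr.le
  · obtain ⟨x, hx, h⟩ := supp_attained hK hne u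
    rw [h, ← inner_smul_right]
    exact supp_le hK hx _

/-- Distance of an interior point to a supporting hyperplane. -/
lemma supp_sub_pos (hK : IsCompact K) {z : EuclideanSpace ℝ (Fin n)} (hz : z ∈ interior K)
    {u : EuclideanSpace ℝ (Fin n)} (hu : u ≠ 0) : 0 < supp K u - ⟪z, u⟫ := by
  have hu' : 0 < ⟪u, u⟫ := by
    rw [real_inner_self_eq_norm_sq]
    have := norm_pos_iff.2 hu
    positivity
  have hc : Filter.Tendsto (fun t : ℝ => z + t • u) (nhdsWithin 0 (Ioi 0)) (nhds z) := by
    have : Continuous (fun t : ℝ => z + t • u) := by fun_prop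
    have h := this.tendsto 0
    simp only [zero_smul, add_zero] at h
    exact h.mono_left nhdsWithin_le_nhds
  have h1 := hc.eventually (mem_interior_iff_mem_nhds.1 hz)
  obtain ⟨t, ht, ht0⟩ := (h1.and self_mem_nhdsWithin).exists
  have h2 := supp_le hK ht u
  rw [inner_add_left, inner_smul_left] at h2
  simp only [conj_trivial] at h2
  have : 0 < t * ⟪u, u⟫ := mul_pos ht0 hu'
  linarith

lemma supp_translate (hK : IsCompact K) (hne : K.Nonempty) (z u : EuclideanSpace ℝ (Fin n)) :
    supp ((fun x => x - z) '' K) u = supp K u - ⟪z, u⟫ := by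
  have hK' : IsCompact ((fun x => x - z) '' K) := hK.image (by fun_prop)
  apply le_antisymm
  · obtain ⟨x, ⟨y, hy, rfl⟩, h⟩ := supp_attained hK' (hne.image _) u
    rw [h, inner_sub_left]
    linarith [supp_le hK hy u]
  · obtain ⟨x, hx, h⟩ := supp_attained hK hne u
    rw [h, ← inner_sub_left]
    exact supp_le hK' ⟨x, hx, rfl⟩ u

lemma gauss_total (n : ℕ) : (∫⁻ x : EuclideanSpace ℝ (Fin n), gs ‖x‖) *
    (∫⁻ x : EuclideanSpace ℝ (Fin n), gs ‖x‖) = ENNReal.ofReal (2 * π) ^ n := by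
  have h := GaussianFourier.integral_rexp_neg_mul_sq_norm (V := EuclideanSpace ℝ (Fin n))
    (b := 1/2) (by norm_num)
  have hi : Integrable (fun x : EuclideanSpace ℝ (Fin n) => exp (-(1/2) * ‖x‖ ^ 2)) := by
    by_contra hc
    rw [integral_undef hc] at h
    have : 0 < (π / (1/2)) ^ ((Module.finrank ℝ (EuclideanSpace ℝ (Fin n)) : ℝ) / 2) := by positivity
    linarith
  have e : ∫⁻ x : EuclideanSpace ℝ (Fin n), gs ‖x‖ =
      ENNReal.ofReal ((2 * π) ^ ((n : ℝ) / 2)) := by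
    have h2 := ofReal_integral_eq_lintegral_ofReal hi (Filter.Eventually.of_forall fun x => (exp_pos _).le)
    rw [h] at h2
    simp only [finrank_euclideanSpace, Fintype.card_fin] at h2
    rw [show π / (1/2) = 2 * π by ring] at h2
    rw [h2]
    refine lintegral_congr fun x => ?_
    unfold gs
    congr 2
    ring
  rw [e, ← ENNReal.ofReal_mul (by positivity), ← ENNReal.ofReal_pow (by positivity),
    ← rpow_add (by positivity), ← rpow_natCast]
  congr 2
  ring

lemma centred (hn : 1 ≤ n) (L : Set (EuclideanSpace ℝ (Fin n))) (hL : IsCompact L)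
    (hc : Convex ℝ L) (h0 : (0 : EuclideanSpace ℝ (Fin n)) ∈ interior L)
    (hbar : ∫ x in L, x = 0)
    (hv : volume L = volume (closedBall (0 : EuclideanSpace ℝ (Fin n)) 1)) :
    ∫⁻ u : sphere (0 : EuclideanSpace ℝ (Fin n)) 1, ENNReal.ofReal ((supp L u)⁻¹ ^ n)
      ∂(volume : Measure (EuclideanSpace ℝ (Fin n))).toSphere ≤
      (volume : Measure (EuclideanSpace ℝ (Fin n))).toSphere univ := by
  have : Nonempty (Fin n) := ⟨⟨0, hn⟩⟩
  have hn0 : L ∈ nhds (0 : EuclideanSpace ℝ (Fin n)) := mem_interior_iff_mem_nhds.1 h0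
  have hne : L.Nonempty := ⟨0, mem_of_mem_nhds hn0⟩
  have habs : Absorbent ℝ L := absorbent_nhds_zero hn0
  have hbdd : Bornology.IsVonNBounded ℝ L := hL.isVonNBounded ℝ
  have hpc : Continuous (gauge L) := continuous_gauge hc hn0
  have hpm := hpc.measurable
  have hph : ∀ (r : ℝ) (x : EuclideanSpace ℝ (Fin n)), 0 < r → gauge L (r • x) = r * gauge L x := by
    intro r x hr
    rw [gauge_smul_of_nonneg hr.le, smul_eq_mul]
  have hpp : ∀ x : EuclideanSpace ℝ (Fin n), x ≠ 0 → 0 < gauge L x := fun x hx =>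
    (gauge_pos habs hbdd).2 hx
  have hpL : ∀ x, gauge L x ≤ 1 ↔ x ∈ L := fun x => by
    rw [gauge_le_one_iff_mem_closure hc hn0, hL.isClosed.closure_eq]
  have hsc := supp_cont hL
  have hsm := hsc.measurable
  have hsh : ∀ (r : ℝ) (x : EuclideanSpace ℝ (Fin n)), 0 < r → supp L (r • x) = r * supp L x :=
    fun r x hr => supp_smul hL hne hr x
  have hsp : ∀ x : EuclideanSpace ℝ (Fin n), x ≠ 0 → 0 < supp L x := fun x hx => by
    have := supp_sub_pos hL h0 hx
    simpa using this
  have hLm : MeasurableSet L := hL.measurableSet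
  have hfin : Module.finrank ℝ (EuclideanSpace ℝ (Fin n)) = n := by simp
  -- polar inequality
  have hps : ∀ x y, ⟪x, y⟫ ≤ gauge L x * supp L y := by
    intro x y
    by_cases hx : x = 0
    · subst hx; simp
    have hp := hpp x hx
    have hm : (gauge L x)⁻¹ • x ∈ L := by
      rw [← hpL, hph _ _ (inv_pos.2 hp), inv_mul_cancel₀ hp.ne']
    have := supp_le hL hm y
    rw [inner_smul_left] at this
    simp only [conj_trivial] at this
    have h3 := mul_le_mul_of_nonneg_left this hp.le
    rwa [← mul_assoc, mul_inv_cancel₀ hp.ne', one_mul] at h3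
  have hgsm := gs_meas
  have key : ∀ (k : ℕ) (w : EuclideanSpace ℝ (Fin n) → ℝ≥0∞), Measurable w →
      (∀ (r : ℝ) x, 0 < r → w (r • x) = ENNReal.ofReal (r ^ k) * w x) →
      ∫⁻ x, w x * gs (gauge L x) = kap n k * ∫⁻ x in L, w x := by
    intro k w hw hwh
    have := gauss_eq_kap volume (gauge L) hpm hph hpp k w hw hwh L hLm hpL
    rwa [hfin] at this
  have hDf : ∫⁻ x, gs (gauge L x) = ∫⁻ x : EuclideanSpace ℝ (Fin n), gs ‖x‖ := by
    have h1 := key 0 1 measurable_one (by simp)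
    have h2 := gauss_eq_kap (volume : Measure (EuclideanSpace ℝ (Fin n))) (fun x => ‖x‖)
      measurable_norm (fun r x hr => by rw [norm_smul, norm_of_nonneg hr.le])
      (fun x hx => norm_pos_iff.2 hx) 0 1 measurable_one (by simp) (closedBall 0 1)
      measurableSet_closedBall (by simp)
    rw [hfin] at h2
    simp only [Pi.one_apply, one_mul, lintegral_one, Measure.restrict_apply MeasurableSet.univ,
      univ_inter] at h1 h2
    rw [h1, h2, hv]
  have hDJ : ∫⁻ x : EuclideanSpace ℝ (Fin n), gs ‖x‖ =
      (volume : Measure (EuclideanSpace ℝ (Fin n))).toSphere univ * Jm n 0 gs := by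
    have h2 := polar_hom (volume : Measure (EuclideanSpace ℝ (Fin n))) (fun x => ‖x‖)
      measurable_norm (fun r x hr => by rw [norm_smul, norm_of_nonneg hr.le])
      (fun x hx => norm_pos_iff.2 hx) 0 1 measurable_one (by simp) gs gs_meas
    rw [hfin] at h2
    simpa using h2
  have hSJ : ∫⁻ x : EuclideanSpace ℝ (Fin n), gs (supp L x) =
      (∫⁻ u : sphere (0 : EuclideanSpace ℝ (Fin n)) 1, ENNReal.ofReal ((supp L u)⁻¹ ^ n)
      ∂(volume : Measure (EuclideanSpace ℝ (Fin n))).toSphere) * Jm n 0 gs := by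
    have h2 := polar_hom (volume : Measure (EuclideanSpace ℝ (Fin n))) (supp L)
      hsm hsh hsp 0 1 measurable_one (by simp) gs gs_meas
    rw [hfin] at h2
    simpa using h2
  have hD2 := gauss_total n
  set D := ∫⁻ x : EuclideanSpace ℝ (Fin n), gs ‖x‖ with hD
  have hDtop : D ≠ ∞ := by
    intro h
    rw [h, ENNReal.top_mul_top] at hD2
    exact ENNReal.pow_ne_top ENNReal.ofReal_ne_top hD2.symm
  have hD0 : D ≠ 0 := by
    intro h
    rw [h, zero_mul] at hD2
    have := hD2.symm
    rw [pow_eq_zero_iff (by omega), ENNReal.ofReal_eq_zero] at this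
    linarith [pi_pos]
  -- the density measure
  have hwl : ∀ (w : EuclideanSpace ℝ (Fin n) → ℝ≥0∞), Measurable w →
      ∫⁻ x, w x ∂(volume.withDensity (fun x => gs (gauge L x))) = ∫⁻ x, w x * gs (gauge L x) := by
    intro w hw
    rw [lintegral_withDensity_eq_lintegral_mul _ (by fun_prop) hw]
    refine lintegral_congr fun x => ?_
    simp [mul_comm]
  have hintL : IntegrableOn (fun x : EuclideanSpace ℝ (Fin n) => x) L :=
    continuous_id.continuousOn.integrableOn_compact hL
  have hIntg : Integrable (fun x : EuclideanSpace ℝ (Fin n) => x)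
      (volume.withDensity (fun x => gs (gauge L x))) := by
    refine ⟨by fun_prop, ?_⟩
    rw [hasFiniteIntegral_iff_norm, hwl _ (by fun_prop), key 1 _ (by fun_prop)]
    · exact ENNReal.mul_lt_top (kap_ne_top n 1).lt_top
        ((hasFiniteIntegral_iff_norm _).1 hintL.hasFiniteIntegral)
    · intro r x hr
      rw [norm_smul, norm_of_nonneg hr.le, ENNReal.ofReal_mul hr.le, pow_one]
  have hb : ∫ x, x ∂(volume.withDensity (fun x => gs (gauge L x))) = 0 := by
    refine ext_inner_left ℝ fun c => ?_
    rw [inner_zero_right, ← integral_inner hIntg,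
      integral_eq_lintegral_pos_part_sub_lintegral_neg_part (hIntg.const_inner c),
      hwl _ (by fun_prop), hwl _ (by fun_prop), key 1 _ (by fun_prop), key 1 _ (by fun_prop),
      ENNReal.toReal_mul, ENNReal.toReal_mul, ← mul_sub,
      ← integral_eq_lintegral_pos_part_sub_lintegral_neg_part (hintL.const_inner c),
      integral_inner hintL, hbar, inner_zero_right, mul_zero]
    · intro r x hr
      rw [inner_smul_right, ← mul_neg, ENNReal.ofReal_mul hr.le, pow_one]
    · intro r x hr
      rw [inner_smul_right, ENNReal.ofReal_mul hr.le, pow_one]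
  have hSP := SP_euclid n (fun x => gs (gauge L x)) (fun y => gs (supp L y)) (by fun_prop)
    (by fun_prop) (by
      intro x y
      unfold gs
      rw [← ENNReal.ofReal_mul (exp_pos _).le, ← exp_add]
      apply ENNReal.ofReal_le_ofReal
      rw [exp_le_exp, innerSL_apply_apply]
      nlinarith [hps x y, sq_nonneg (gauge L x - supp L y)]) (by rw [hDf]; exact hDtop) hIntg hb
  rw [hDf, ← hD2, ENNReal.mul_le_mul_iff_right hD0 hDtop, hSJ, hDJ] at hSP
  exact (ENNReal.mul_le_mul_iff_left (Jm_gs_ne_zero n 0) (Jm_gs_ne_top n 0)).1 hSP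
end


section
variable {n : ℕ} {K : Set (EuclideanSpace ℝ (Fin n))}

lemma sep_interior (hc : Convex ℝ K) (hcl : IsClosed K) (hne : (interior K).Nonempty)
    {z : EuclideanSpace ℝ (Fin n)} (hz : z ∉ interior K) :
    ∃ f : EuclideanSpace ℝ (Fin n) →L[ℝ] ℝ, (∀ a ∈ interior K, f a < f z) ∧ ∀ x ∈ K, f x ≤ f z := by
  obtain ⟨f, hf⟩ := geometric_hahn_banach_open_point hc.interior isOpen_interior hz
  refine ⟨f, hf, fun x hx => ?_⟩
  have h1 : K ⊆ closure (interior K) := by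
    rw [hc.closure_interior_eq_closure_of_nonempty_interior hne]
    exact subset_closure
  have h2 : closure (interior K) ⊆ {x | f x ≤ f z} :=
    closure_minimal (fun a ha => (hf a ha).le) (isClosed_le f.continuous continuous_const)
  exact h2 (h1 hx)

lemma centroid_mem (hK : IsConvexBody K) :
    (⨍ x in K, x) ∈ interior K := by
  obtain ⟨hcp, hc, hne⟩ := hK
  by_contra hz
  obtain ⟨f, hf, hf'⟩ := sep_interior hc hcp.isClosed hne hz
  have hpos : 0 < volume (interior K) := isOpen_interior.measure_pos _ hne
  have hK0 : volume K ≠ 0 := (hpos.trans_le (measure_mono interior_subset)).ne'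
  have hKt : volume K ≠ ∞ := hcp.measure_lt_top.ne
  set z := ⨍ x in K, x with hzdef
  have hintL : IntegrableOn (fun x : EuclideanSpace ℝ (Fin n) => x) K :=
    continuous_id.continuousOn.integrableOn_compact hcp
  have hi2 : IntegrableOn (fun x => f z - f x) K :=
    (by fun_prop : Continuous fun x => f z - f x).continuousOn.integrableOn_compact hcp
  have hz1 : volume.real K • z = ∫ x in K, x := measure_smul_setAverage _ hKt
  have hI : ∫ x in K, (f z - f x) = 0 := by
    have hconst : Integrable (fun _ : EuclideanSpace ℝ (Fin n) => f z) (volume.restrict K) :=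
      integrableOn_const hKt
    rw [integral_sub hconst (f.integrable_comp hintL),
      ContinuousLinearMap.integral_comp_comm f hintL, ← hz1, map_smul]
    simp
  rw [setIntegral_eq_zero_iff_of_nonneg_ae] at hI
  · rw [Filter.EventuallyEq, ae_restrict_iff' hcp.measurableSet] at hI
    refine hpos.ne' (measure_mono_null ?_ hI)
    intro x hx hcx
    have h1 := hcx (interior_subset hx)
    have h2 := hf x hx
    simp only [Pi.zero_apply] at h1
    linarith
  · rw [Filter.EventuallyLE, ae_restrict_iff' hcp.measurableSet]
    exact Filter.Eventually.of_forall fun x hx => by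
      have := hf' x hx
      simp only [Pi.zero_apply]
      linarith
  · exact hi2

lemma sph_integrable {F : sphere (0 : EuclideanSpace ℝ (Fin n)) 1 → ℝ} (hF : Continuous F) :
    Integrable F (sphMeasure n) := by
  unfold sphMeasure
  rw [← integrableOn_univ]
  exact hF.continuousOn.integrableOn_compact isCompact_univ

lemma sph_ne_zero (u : sphere (0 : EuclideanSpace ℝ (Fin n)) 1) :
    (u : EuclideanSpace ℝ (Fin n)) ≠ 0 := by
  intro h
  have := u.2
  rw [h] at this
  simp at this

lemma bern (n : ℕ) (hn : 2 ≤ n) {t : ℝ} (ht : 0 < t) :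
    t ^ 2 ≤ (2 / n : ℝ) * t ^ n + (1 - 2 / n) := by
  have hn' : (2:ℝ) ≤ n := by exact_mod_cast hn
  have h := one_add_mul_self_le_rpow_one_add (s := t ^ 2 - 1) (by nlinarith [sq_nonneg t])
    (p := (n:ℝ) / 2) (by linarith)
  have e : (1 + (t ^ 2 - 1)) ^ ((n:ℝ) / 2) = t ^ n := by
    rw [show 1 + (t ^ 2 - 1) = t ^ (2:ℝ) by rw [rpow_two]; ring, ← rpow_mul ht.le,
      show (2:ℝ) * (n / 2) = n by ring, rpow_natCast]
  rw [e] at h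
  have h2 := mul_le_mul_of_nonneg_left h (by positivity : (0:ℝ) ≤ 2 / n)
  have e2 : (2 / n : ℝ) * (1 + n / 2 * (t ^ 2 - 1)) = 2 / n + (t ^ 2 - 1) := by
    field_simp
  linarith

lemma pow_neg_two {x : ℝ} : x ^ (-2 : ℝ) = (x⁻¹) ^ 2 := by
  rw [show (-2:ℝ) = ((-2 : ℤ) : ℝ) by norm_num, rpow_intCast]
  simp [zpow_neg]

lemma cont_inv (hK : IsCompact K) {z : EuclideanSpace ℝ (Fin n)} (hz : z ∈ interior K) :
    Continuous fun u : sphere (0 : EuclideanSpace ℝ (Fin n)) 1 =>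
      (supp K u - ⟪z, (u : EuclideanSpace ℝ (Fin n))⟫)⁻¹ := by
  have h := supp_cont hK
  refine Continuous.inv₀ (by fun_prop) fun u => (supp_sub_pos hK hz (sph_ne_zero u)).ne'

lemma exists_good_ge_two (hn : 2 ≤ n) (hK : IsConvexBody K)
    (hvol : volume K = volume (closedBall (0 : EuclideanSpace ℝ (Fin n)) 1)) :
    ∃ z ∈ interior K, ∫ u, (supp K u - ⟪z, (u : EuclideanSpace ℝ (Fin n))⟫) ^ (-2 : ℝ)
      ∂(sphMeasure n) ≤ (sphMeasure n).real univ := by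
  have hz := centroid_mem hK
  obtain ⟨hcp, hc, hne⟩ := hK
  have hneK : K.Nonempty := hne.mono interior_subset
  have hKt : volume K ≠ ∞ := hcp.measure_lt_top.ne
  have hz1 : volume.real K • (⨍ x in K, x) = ∫ x in K, x := measure_smul_setAverage _ hKt
  set z := ⨍ x in K, x with hzdef
  refine ⟨z, hz, ?_⟩
  have hintL : IntegrableOn (fun x : EuclideanSpace ℝ (Fin n) => x) K :=
    continuous_id.continuousOn.integrableOn_compact hcp
  have hmp := measurePreserving_sub_right (volume : Measure (EuclideanSpace ℝ (Fin n))) z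
  have hemb : MeasurableEmbedding (fun x : EuclideanSpace ℝ (Fin n) => x - z) :=
    (Homeomorph.subRight z).measurableEmbedding
  have hC := centred (by omega) ((fun x => x - z) '' K) (hcp.image (by fun_prop))
    (by
      have := hc.translate (-z)
      simpa [sub_eq_neg_add] using this)
    (by
      have : interior ((fun x => x - z) '' K) = (fun x => x - z) '' interior K :=
        ((Homeomorph.subRight z).image_interior K).symm
      rw [this]
      exact ⟨z, hz, by simp⟩)
    (by
      rw [hmp.setIntegral_image_emb hemb, integral_sub hintL (integrableOn_const hKt), ← hz1]
      simp)
    (by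
      rw [← hvol]
      have := hmp.measure_preimage_emb hemb ((fun x => x - z) '' K)
      rw [← this, preimage_image_eq _ hemb.injective])
  have hci := cont_inv hcp hz
  have hle : ∫ u : sphere (0 : EuclideanSpace ℝ (Fin n)) 1,
      (supp K u - ⟪z, (u : EuclideanSpace ℝ (Fin n))⟫)⁻¹ ^ n
      ∂(sphMeasure n) ≤ (sphMeasure n).real univ := by
    rw [integral_eq_lintegral_of_nonneg_ae]
    · refine ENNReal.toReal_mono ?_ ?_
      · unfold sphMeasure
        exact measure_ne_top _ _
      · refine le_trans (le_of_eq ?_) hC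
        unfold sphMeasure
        refine lintegral_congr fun u => ?_
        rw [supp_translate hcp hneK]
    · exact Filter.Eventually.of_forall fun u => by
        have := supp_sub_pos hcp hz (sph_ne_zero u)
        simp only [Pi.zero_apply]
        positivity
    · exact (hci.pow n).aestronglyMeasurable
  have hn' : (2:ℝ) ≤ n := by exact_mod_cast hn
  have hfm : IsFiniteMeasure (sphMeasure n) := by unfold sphMeasure; infer_instance
  calc ∫ u, (supp K u - ⟪z, (u : EuclideanSpace ℝ (Fin n))⟫) ^ (-2 : ℝ) ∂(sphMeasure n)
      ≤ ∫ u, ((2 / n : ℝ) * (supp K u - ⟪z, (u : EuclideanSpace ℝ (Fin n))⟫)⁻¹ ^ n + (1 - 2 / n))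
        ∂(sphMeasure n) := by
        simp only [pow_neg_two]
        refine integral_mono (sph_integrable (hci.pow 2))
          (sph_integrable ((continuous_const.mul (hci.pow n)).add continuous_const)) fun u => ?_
        exact bern n hn (inv_pos.2 (supp_sub_pos hcp hz (sph_ne_zero u)))
    _ = (2 / n : ℝ) * ∫ u : sphere (0 : EuclideanSpace ℝ (Fin n)) 1,
        (supp K u - ⟪z, (u : EuclideanSpace ℝ (Fin n))⟫)⁻¹ ^ n ∂(sphMeasure n)
        + (1 - 2 / n) * (sphMeasure n).real univ := by
        have hI : Integrable (fun u : sphere (0 : EuclideanSpace ℝ (Fin n)) 1 => (2 / n : ℝ) *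
            (supp K u - ⟪z, (u : EuclideanSpace ℝ (Fin n))⟫)⁻¹ ^ n) (sphMeasure n) :=
          sph_integrable (continuous_const.mul (hci.pow n))
        rw [integral_add hI (integrable_const _), integral_const_mul, integral_const, smul_eq_mul]
        ring
    _ ≤ (2 / n : ℝ) * (sphMeasure n).real univ + (1 - 2 / n) * (sphMeasure n).real univ := by
        gcongr
    _ = (sphMeasure n).real univ := by ring

lemma exists_good_one {K : Set (EuclideanSpace ℝ (Fin 1))} (hK : IsConvexBody K)
    (hvol : volume K = volume (closedBall (0 : EuclideanSpace ℝ (Fin 1)) 1)) :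
    ∃ z ∈ interior K, ∫ u, (supp K u - ⟪z, (u : EuclideanSpace ℝ (Fin 1))⟫) ^ (-2 : ℝ)
      ∂(sphMeasure 1) ≤ (sphMeasure 1).real univ := by
  obtain ⟨hcp, hc, hne⟩ := hK
  have hneK : K.Nonempty := hne.mono interior_subset
  have hin : ∀ x y : EuclideanSpace ℝ (Fin 1), ⟪x, y⟫ = x 0 * y 0 := by
    intro x y
    simp [PiLp.inner_apply, mul_comm]
  have hnorm : ∀ x : EuclideanSpace ℝ (Fin 1), ‖x‖ = |x 0| := by
    intro x
    simp [EuclideanSpace.norm_eq, Real.sqrt_sq_eq_abs]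
  obtain ⟨a, ha, hamin⟩ := hcp.exists_isMinOn hneK
    (f := fun x : EuclideanSpace ℝ (Fin 1) => x 0) (by fun_prop)
  obtain ⟨b, hb, hbmax⟩ := hcp.exists_isMaxOn hneK
    (f := fun x : EuclideanSpace ℝ (Fin 1) => x 0) (by fun_prop)
  have hA : ∀ x ∈ K, a 0 ≤ x 0 := fun x hx => hamin hx
  have hB : ∀ x ∈ K, x 0 ≤ b 0 := fun x hx => hbmax hx
  set z : EuclideanSpace ℝ (Fin 1) := (1/2 : ℝ) • (a + b) with hz
  have hz0 : z 0 = (a 0 + b 0) / 2 := by simp [hz]; ring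
  set r := (b 0 - a 0) / 2 with hr
  have hr0 : 0 ≤ r := by have := hA b hb; rw [hr]; linarith
  have hsub : K ⊆ closedBall z r := by
    intro x hx
    rw [mem_closedBall, dist_eq_norm, hnorm, PiLp.sub_apply, hz0, abs_le]
    constructor <;> linarith [hA x hx, hB x hx]
  have hr1 : 1 ≤ r := by
    have h1 := measure_mono (μ := volume) hsub
    rw [hvol, Measure.addHaar_closedBall volume z hr0, ← Measure.addHaar_closedBall_eq_addHaar_ball] at h1
    have hp : volume (closedBall (0 : EuclideanSpace ℝ (Fin 1)) 1) ≠ 0 :=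
      (measure_closedBall_pos _ _ one_pos).ne'
    have ht : volume (closedBall (0 : EuclideanSpace ℝ (Fin 1)) 1) ≠ ∞ :=
      measure_closedBall_lt_top.ne
    nth_rewrite 1 [← one_mul (volume (closedBall (0 : EuclideanSpace ℝ (Fin 1)) 1))] at h1
    rw [ENNReal.mul_le_mul_iff_left hp ht] at h1
    simpa using h1
  have hzi : z ∈ interior K := by
    by_contra hzi
    obtain ⟨f, hf, hf'⟩ := sep_interior hc hcp.isClosed hne hzi
    have hfe : ∀ x : EuclideanSpace ℝ (Fin 1), f x = x 0 * f (EuclideanSpace.single 0 1) := by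
      intro x
      rw [← smul_eq_mul, ← map_smul]
      congr 1
      ext i
      fin_cases i
      simp
    have h1 := hf' a ha
    have h2 := hf' b hb
    rw [hfe a, hfe z, hz0] at h1
    rw [hfe b, hfe z, hz0] at h2
    have h3 : f (EuclideanSpace.single 0 1) = 0 := by
      have h4 : r * f (EuclideanSpace.single 0 1) = 0 := by rw [hr]; nlinarith
      rcases mul_eq_zero.1 h4 with h | h
      · linarith
      · exact h
    obtain ⟨y, hy⟩ := hne
    have h5 := hf y hy
    rw [hfe y, hfe z, h3] at h5
    simp at h5
  refine ⟨z, hzi, ?_⟩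
  have hfm : IsFiniteMeasure (sphMeasure 1) := by unfold sphMeasure; infer_instance
  have hci := cont_inv hcp hzi
  have h1 : (sphMeasure 1).real univ = ∫ u, (1:ℝ) ∂(sphMeasure 1) := by simp
  rw [h1]
  simp only [pow_neg_two]
  refine integral_mono (sph_integrable (hci.pow 2)) (integrable_const _) fun u => ?_
  have hu : |(u : EuclideanSpace ℝ (Fin 1)) 0| = 1 := by
    rw [← hnorm]; simpa using u.2
  have hge : 1 ≤ supp K u - ⟪z, (u : EuclideanSpace ℝ (Fin 1))⟫ := by
    have ha' := supp_le hcp ha u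
    have hb' := supp_le hcp hb u
    rw [hin] at ha' hb' ⊢
    rw [hz0]
    rcases (abs_eq zero_le_one).1 hu with h | h <;> rw [h] at ha' hb' ⊢ <;> linarith
  exact pow_le_one₀ (by positivity) (inv_le_one_of_one_le₀ hge)

end

/-- If `V(K) = V(B)` and `e₂` minimizes `x ↦ ∫ (s_K - x·u)^{-2} dθ`
over `int K`, then `∫ log (s_K(u) - e₂·u) dθ ≥ 0`. -/
theorem statement9 (n : ℕ) (hn : 1 ≤ n)
    (K : Set (EuclideanSpace ℝ (Fin n))) (hK : IsConvexBody K)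
    (hvol : vol K = vol (unitBall n))
    (e₂ : EuclideanSpace ℝ (Fin n)) (he₂ : e₂ ∈ interior K)
    (he₂min : ∀ x ∈ interior K,
      (∫ u, (supp K u - ⟪e₂, (u : EuclideanSpace ℝ (Fin n))⟫) ^ (-2 : ℝ) ∂(sphMeasure n))
        ≤ ∫ u, (supp K u - ⟪x, (u : EuclideanSpace ℝ (Fin n))⟫) ^ (-2 : ℝ) ∂(sphMeasure n)) :
    0 ≤ ∫ u, Real.log (supp K u - ⟪e₂, (u : EuclideanSpace ℝ (Fin n))⟫) ∂(sphMeasure n) := by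
  have hv : volume K = volume (closedBall (0 : EuclideanSpace ℝ (Fin n)) 1) := by
    unfold vol unitBall at hvol
    exact (ENNReal.toReal_eq_toReal_iff' hK.1.measure_lt_top.ne measure_closedBall_lt_top.ne).1 hvol
  have hex : ∃ z ∈ interior K, ∫ u, (supp K u - ⟪z, (u : EuclideanSpace ℝ (Fin n))⟫) ^ (-2 : ℝ)
      ∂(sphMeasure n) ≤ (sphMeasure n).real univ := by
    rcases Nat.lt_or_ge n 2 with h | h
    · obtain rfl : n = 1 := by omega
      exact exists_good_one hK hv
    · exact exists_good_ge_two h hK hv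
  obtain ⟨z, hz, hzle⟩ := hex
  have hle := (he₂min z hz).trans hzle
  have hfm : IsFiniteMeasure (sphMeasure n) := by unfold sphMeasure; infer_instance
  have hci := cont_inv hK.1 he₂
  have hsc := supp_cont hK.1
  have hpos : ∀ u : sphere (0 : EuclideanSpace ℝ (Fin n)) 1,
      0 < supp K u - ⟪e₂, (u : EuclideanSpace ℝ (Fin n))⟫ :=
    fun u => supp_sub_pos hK.1 he₂ (sph_ne_zero u)
  have hlog : Continuous fun u : sphere (0 : EuclideanSpace ℝ (Fin n)) 1 =>
      Real.log (supp K u - ⟪e₂, (u : EuclideanSpace ℝ (Fin n))⟫) :=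
    Continuous.log (by fun_prop) fun u => (hpos u).ne'
  simp only [pow_neg_two] at hle
  have h1 : ∫ u : sphere (0 : EuclideanSpace ℝ (Fin n)) 1,
      (1 / 2 : ℝ) * (1 - (supp K u - ⟪e₂, (u : EuclideanSpace ℝ (Fin n))⟫)⁻¹ ^ 2) ∂(sphMeasure n) ≤
      ∫ u, Real.log (supp K u - ⟪e₂, (u : EuclideanSpace ℝ (Fin n))⟫) ∂(sphMeasure n) := by
    refine integral_mono (sph_integrable
      (continuous_const.mul (continuous_const.sub (hci.pow 2)))) (sph_integrable hlog) fun u => ?_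
    have h := hpos u
    have h2 := Real.log_le_sub_one_of_pos (pow_pos (inv_pos.2 h) 2)
    rw [Real.log_pow, Real.log_inv] at h2
    push_cast at h2
    simp only
    linarith
  have hI : Integrable (fun u : sphere (0 : EuclideanSpace ℝ (Fin n)) 1 =>
      (supp K u - ⟪e₂, (u : EuclideanSpace ℝ (Fin n))⟫)⁻¹ ^ 2) (sphMeasure n) :=
    sph_integrable (hci.pow 2)
  rw [integral_const_mul, integral_sub (integrable_const _) hI] at h1
  simp only [integral_const, smul_eq_mul, mul_one] at h1
  linarith
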